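/- arXiv:1803.08905 — 3 statements merged into one kernel-verified Lean document; each statement's English description precedes it below -/
import Mathlib

section
/- Let ε > 0. There exists S such that for every odd integer s ≥ S, the number of odd integers i with 3 ≤ i ≤ s for which ζ(i) is irrational is at least 2^{(1-ε)·(log s)/(log log s)}. -/
/-- The Riemann zeta value `ζ(i) = ∑_{m ≥ 1} 1/m^i`, as a real number. -/
noncomputable def zetaVal (i : ℕ) : ℝ := ∑' m : ℕ, 1 / ((m : ℝ) + 1) ^ i

open scoped PowerSeries Nat

namespace OddZeta

/-- The power series `f` over `ℚ` such that `d ^ m * coeff m f` is an integer for all `m`. -/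
noncomputable def clearedSubring (d : ℕ) : Subring ℚ⟦X⟧ :=
  ((PowerSeries.map (Int.castRingHom ℚ)).range).comap (PowerSeries.rescale (d : ℚ))

lemma mem_clearedSubring {d : ℕ} {f : ℚ⟦X⟧} :
    f ∈ clearedSubring d ↔ ∀ m, ∃ z : ℤ, (d : ℚ) ^ m * PowerSeries.coeff m f = z := by
  simp only [clearedSubring, Subring.mem_comap, RingHom.mem_range]
  constructor
  · rintro ⟨g, hg⟩ m
    refine ⟨PowerSeries.coeff m g, ?_⟩
    rw [← PowerSeries.coeff_rescale, ← hg]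
    simp
  · intro h
    choose z hz using h
    refine ⟨PowerSeries.mk z, ?_⟩
    ext m
    simp [PowerSeries.coeff_rescale, hz]

lemma C_int_mem_clearedSubring (d : ℕ) (z : ℤ) : PowerSeries.C (z : ℚ) ∈ clearedSubring d := by
  have : PowerSeries.C (z : ℚ) = ((z : ℤ) : ℚ⟦X⟧) := by simp
  rw [this]
  exact intCast_mem _ z

lemma C_mem_clearedSubring_of_eq {d : ℕ} {x : ℚ} (h : ∃ z : ℤ, x = z) :
    PowerSeries.C x ∈ clearedSubring d := by
  obtain ⟨z, rfl⟩ := h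
  exact C_int_mem_clearedSubring d z

lemma C_mul_X_mem_clearedSubring {d : ℕ} {x : ℚ} (h : ∃ z : ℤ, d * x = z) :
    PowerSeries.C x * PowerSeries.X ∈ clearedSubring d := by
  rw [mem_clearedSubring]
  intro m
  obtain ⟨z, hz⟩ := h
  by_cases hm : m = 1
  · subst hm
    exact ⟨z, by simpa [PowerSeries.coeff_X] using hz⟩
  · exact ⟨0, by simp [PowerSeries.coeff_X, hm]⟩

/-- The rising product `∏_{i < a} (D X + c + i)`. -/
noncomputable def block (D a : ℕ) (c : ℤ) : ℚ⟦X⟧ :=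
  ∏ i ∈ Finset.range a, (PowerSeries.C (D : ℚ) * PowerSeries.X + PowerSeries.C ((c : ℚ) + i))

lemma block_add (D a b : ℕ) (c : ℤ) : block D (a + b) c = block D a c * block D b (c + a) := by
  simp only [block, Finset.prod_range_add]
  congr 1
  refine Finset.prod_congr rfl fun i _ => ?_
  push_cast
  rw [add_assoc]

lemma block_one (D : ℕ) (c : ℤ) :
    block D 1 c = PowerSeries.C (D : ℚ) * PowerSeries.X + PowerSeries.C (c : ℚ) := by
  simp [block]

lemma block_zero (D : ℕ) (c : ℤ) : block D 0 c = 1 := by simp [block]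

lemma block_succ_right (D a : ℕ) (c : ℤ) : block D (a + 1) c =
    block D a c * (PowerSeries.C (D : ℚ) * PowerSeries.X + PowerSeries.C ((c : ℚ) + a)) := by
  rw [block_add, block_one]; push_cast; rfl

lemma block_succ_left (D a : ℕ) (c : ℤ) : block D (a + 1) c =
    (PowerSeries.C (D : ℚ) * PowerSeries.X + PowerSeries.C (c : ℚ)) * block D a (c + 1) := by
  rw [add_comm, block_add, block_one]; push_cast; rfl

lemma block_add_one_sub (D a : ℕ) (c : ℤ) : block D (a + 1) (c + 1) - block D (a + 1) c =
    PowerSeries.C ((a : ℚ) + 1) * block D a (c + 1) := by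
  rw [block_succ_right, block_succ_left]
  simp only [map_add, Int.cast_add, Int.cast_one]
  simp
  ring

lemma int_mul_inv {d l : ℕ} (hl : l ≠ 0) (h : l ∣ d) (x : ℤ) : ∃ z : ℤ, (d : ℚ) * (x / l) = z := by
  obtain ⟨e, rfl⟩ := h
  refine ⟨e * x, ?_⟩
  have : (l : ℚ) ≠ 0 := by exact_mod_cast hl
  push_cast
  field_simp

lemma block_one_start_mem {n d : ℕ} (hd : ∀ l, 1 ≤ l → l ≤ n → l ∣ d) (D a : ℕ) (ha : a ≤ n) :
    PowerSeries.C (1 / (a ! : ℚ)) * block D a 1 ∈ clearedSubring d := by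
  induction a with
  | zero => simp [block_zero]
  | succ a ih =>
    have h : PowerSeries.C (1 / ((a + 1)! : ℚ)) * block D (a + 1) 1 =
        (PowerSeries.C (1 / (a ! : ℚ)) * block D a 1) *
        (PowerSeries.C (((D : ℤ) : ℚ) / ((a + 1 : ℕ) : ℚ)) * PowerSeries.X + 1) := by
      have e1 : PowerSeries.C (1 / ((a + 1)! : ℚ)) =
          PowerSeries.C (1 / (a ! : ℚ)) * PowerSeries.C (1 / ((a + 1 : ℕ) : ℚ)) := by
        rw [← map_mul, Nat.factorial_succ]; congr 1; push_cast; field_simp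
      have e2 : PowerSeries.C (1 / ((a + 1 : ℕ) : ℚ)) *
          (PowerSeries.C (D : ℚ) * PowerSeries.X + PowerSeries.C (((1 : ℤ) : ℚ) + a)) =
          PowerSeries.C (((D : ℤ) : ℚ) / ((a + 1 : ℕ) : ℚ)) * PowerSeries.X + 1 := by
        rw [mul_add, ← mul_assoc, ← map_mul, ← map_mul, ← map_one PowerSeries.C]
        congr 2
        · congr 1; push_cast; field_simp
        · push_cast; field_simp; ring
      rw [block_succ_right, e1, ← e2]
      ring
    rw [h]
    refine mul_mem (ih (by omega)) (add_mem (C_mul_X_mem_clearedSubring ?_) (one_mem _))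
    exact int_mul_inv (by omega) (hd _ (by omega) ha) _

lemma block_div_factorial_mem {n d : ℕ} (hd : ∀ l, 1 ≤ l → l ≤ n → l ∣ d) (D a : ℕ) (ha : a ≤ n)
    (c : ℤ) : PowerSeries.C (1 / (a ! : ℚ)) * block D a c ∈ clearedSubring d := by
  induction a generalizing c with
  | zero => simp [block_zero]
  | succ a ih =>
    have h (c : ℤ) : PowerSeries.C (1 / ((a + 1)! : ℚ)) * block D (a + 1) (c + 1) -
        PowerSeries.C (1 / ((a + 1)! : ℚ)) * block D (a + 1) c =
        PowerSeries.C (1 / (a ! : ℚ)) * block D a (c + 1) := by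
      rw [← mul_sub, block_add_one_sub, ← mul_assoc, ← map_mul, Nat.factorial_succ]
      congr 2
      push_cast
      field_simp
    induction c using Int.induction_on with
    | zero =>
      have := sub_mem (block_one_start_mem hd D (a + 1) ha) (ih (by omega) 1)
      have h0 := h 0
      rw [zero_add] at h0
      rwa [← h0, sub_sub_cancel] at this
    | succ i hi =>
      have := add_mem (ih (by omega) ((i : ℤ) + 1)) hi
      rwa [← h, sub_add_cancel] at this
    | pred i hi =>
      have h0 := h (-(i : ℤ) - 1)
      rw [sub_add_cancel] at h0
      have := sub_mem hi (ih (by omega) (-(i : ℤ)))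
      rwa [← h0, sub_sub_cancel] at this

lemma block_mul_div_factorial_pow_mem {n d : ℕ} (hd : ∀ l, 1 ≤ l → l ≤ n → l ∣ d) (D q : ℕ)
    (c : ℤ) : PowerSeries.C (1 / (n ! : ℚ) ^ q) * block D (q * n) c ∈ clearedSubring d := by
  induction q with
  | zero => simp [block_zero]
  | succ q ih =>
    have h := mul_mem ih (block_div_factorial_mem hd D n le_rfl (c + (q * n : ℕ)))
    have e : PowerSeries.C (1 / (n ! : ℚ) ^ (q + 1)) =
        PowerSeries.C (1 / (n ! : ℚ) ^ q) * PowerSeries.C (1 / (n ! : ℚ)) := by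
      rw [← map_mul, pow_succ]; congr 1; field_simp
    rw [add_mul, one_mul, block_add, e]
    convert h using 1
    ring

lemma mul_beta_int {n d : ℕ} (hd : ∀ l, 1 ≤ l → l ≤ n → l ∣ d) (a b : ℕ) (h : a + b + 1 ≤ n) :
    ∃ z : ℤ, (d : ℚ) * ((a ! : ℚ) * b ! / (a + b + 1)!) = z := by
  induction b generalizing a with
  | zero =>
    obtain ⟨z, hz⟩ := int_mul_inv (d := d) (l := a + 1) (by omega) (hd _ (by omega) (by omega)) 1
    refine ⟨z, ?_⟩
    rw [← hz, add_zero, Nat.factorial_succ]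
    push_cast
    field_simp
    simp
  | succ b ih =>
    obtain ⟨z, hz⟩ := ih a (by omega)
    obtain ⟨w, hw⟩ := ih (a + 1) (by omega)
    refine ⟨z - w, ?_⟩
    push_cast
    rw [← hz, ← hw, show a + 1 + b + 1 = a + b + 1 + 1 by ring,
      show a + (b + 1) + 1 = a + b + 1 + 1 by ring, Nat.factorial_succ (a + b + 1),
      Nat.factorial_succ a, Nat.factorial_succ b]
    push_cast
    field_simp
    ring

lemma block_mul_block_mem {n d : ℕ} (hd : ∀ l, 1 ≤ l → l ≤ n → l ∣ d) (D a b : ℕ)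
    (h : a + b + 1 = n) (c c' : ℤ) :
    PowerSeries.C ((d : ℚ) / n !) * (block D a c * block D b c') ∈ clearedSubring d := by
  have h1 := mul_mem (block_div_factorial_mem hd D a (by omega) c)
    (block_div_factorial_mem hd D b (by omega) c')
  have h2 := mul_mem (C_mem_clearedSubring_of_eq (d := d) (mul_beta_int hd a b h.le)) h1
  rw [h] at h2
  have e : PowerSeries.C ((d : ℚ) / n !) = PowerSeries.C ((d : ℚ) * ((a ! : ℚ) * b ! / n !)) *
      (PowerSeries.C (1 / (a ! : ℚ)) * PowerSeries.C (1 / (b ! : ℚ))) := by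
    rw [← map_mul, ← map_mul]; congr 1; field_simp
  rw [e]
  convert h2 using 1
  ring

/-- Removing one factor from a long block only costs one more factor `d` in the denominator. -/
lemma exists_block_eq_mul {n d : ℕ} (hd : ∀ l, 1 ≤ l → l ≤ n → l ∣ d) (D q : ℕ)
    (c : ℤ) (j : ℕ) (hj : j < q * n) :
    ∃ g : ℚ⟦X⟧, PowerSeries.C ((d : ℚ) / (n ! : ℚ) ^ q) * g ∈ clearedSubring d ∧
      block D (q * n) c =
        (PowerSeries.C (D : ℚ) * PowerSeries.X + PowerSeries.C ((c : ℚ) + j)) * g := by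
  have hn : 0 < n := Nat.pos_of_ne_zero (by rintro rfl; simp at hj)
  set l := j / n with hl
  set i := j % n with hi
  have hji : l * n + i = j := by rw [mul_comm]; exact Nat.div_add_mod j n
  have hin : i < n := Nat.mod_lt _ hn
  have hlq : l < q := (Nat.div_lt_iff_lt_mul hn).2 hj
  obtain ⟨q', rfl⟩ : ∃ q', q = l + 1 + q' := ⟨q - l - 1, by omega⟩
  obtain ⟨b, hb⟩ : ∃ b, i + b + 1 = n := ⟨n - i - 1, by omega⟩
  refine ⟨block D (l * n) c * (block D i (c + (l * n : ℕ)) * block D b (c + (j + 1 : ℕ))) *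
    block D (q' * n) (c + ((l + 1) * n : ℕ)), ?_, ?_⟩
  · have h := mul_mem (mul_mem (block_mul_div_factorial_pow_mem hd D l c)
      (block_mul_block_mem hd D i b hb (c + (l * n : ℕ)) (c + (j + 1 : ℕ))))
      (block_mul_div_factorial_pow_mem hd D q' (c + ((l + 1) * n : ℕ)))
    have e : PowerSeries.C ((d : ℚ) / (n ! : ℚ) ^ (l + 1 + q')) =
        PowerSeries.C (1 / (n ! : ℚ) ^ l) * PowerSeries.C ((d : ℚ) / n !) *
          PowerSeries.C (1 / (n ! : ℚ) ^ q') := by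
      rw [← map_mul, ← map_mul]; congr 1; field_simp; ring
    rw [e]
    convert h using 1
    ring
  · have e : (l + 1 + q') * n = (l * n + i + 1 + b) + q' * n := by rw [← hb]; ring
    rw [e, block_add, block_add, block_succ_right, block_add]
    have e2 : l * n + i + 1 + b = (l + 1) * n := by
      calc l * n + i + 1 + b = l * n + (i + b + 1) := by ring
        _ = _ := by rw [hb]; ring
    rw [e2, hji]
    ring

end OddZeta

namespace OddZeta

/-- The expansion of `1 / (l + X)`. -/
noncomputable def invLin (l : ℚ) : ℚ⟦X⟧ := PowerSeries.mk fun m => (-1) ^ m / l ^ (m + 1)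

lemma X_add_C_mul_invLin {l : ℚ} (hl : l ≠ 0) :
    (PowerSeries.X + PowerSeries.C l) * invLin l = 1 := by
  ext m
  rw [add_mul, map_add, PowerSeries.coeff_C_mul]
  cases m with
  | zero => simp [invLin, hl]
  | succ m =>
    rw [PowerSeries.coeff_succ_X_mul]
    simp only [invLin, PowerSeries.coeff_mk, PowerSeries.coeff_one]
    simp only [Nat.add_eq_zero_iff, one_ne_zero, and_false, if_false]
    field_simp
    ring

lemma C_mul_invLin_mem {d : ℕ} {l : ℚ} (hl : l ≠ 0) (h : ∃ z : ℤ, (d : ℚ) / l = z) :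
    PowerSeries.C l * invLin l ∈ clearedSubring d := by
  rw [mem_clearedSubring]
  intro m
  obtain ⟨z, hz⟩ := h
  refine ⟨(-1) ^ m * z ^ m, ?_⟩
  push_cast
  rw [← hz, PowerSeries.coeff_C_mul, invLin, PowerSeries.coeff_mk, div_pow]
  field_simp
  ring

lemma evalNegHom_C (x : ℚ) : PowerSeries.evalNegHom (PowerSeries.C x) = PowerSeries.C x := by
  ext m
  rw [PowerSeries.evalNegHom, PowerSeries.coeff_rescale]
  cases m <;> simp [PowerSeries.coeff_C]

lemma coeff_evalNegHom (f : ℚ⟦X⟧) (m : ℕ) :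
    PowerSeries.coeff m (PowerSeries.evalNegHom f) = (-1) ^ m * PowerSeries.coeff m f := by
  rw [PowerSeries.evalNegHom, PowerSeries.coeff_rescale]

lemma evalNegHom_invLin (l : ℚ) : PowerSeries.evalNegHom (invLin l) = - invLin (-l) := by
  ext m
  rw [coeff_evalNegHom]
  simp only [invLin, PowerSeries.coeff_mk, map_neg]
  rw [neg_pow l, pow_succ (-1 : ℚ)]
  rcases neg_one_pow_eq_or ℚ m with h | h <;> rw [h] <;> simp [neg_div, div_neg]

/-- The expansion of `∏_{j ≤ n, j ≠ k} 1 / (t + j)` at `t = -k`. -/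
noncomputable def cofac (n k : ℕ) : ℚ⟦X⟧ :=
  (∏ i ∈ Finset.range k, invLin (-((i : ℚ) + 1))) *
    ∏ i ∈ Finset.range (n - k), invLin ((i : ℚ) + 1)

lemma range_succ_erase_prod {M : Type*} [CommMonoid M] {n k : ℕ} (hk : k ≤ n) (f : ℤ → M) :
    ∏ j ∈ (Finset.range (n + 1)).erase k, f ((j : ℤ) - k) =
      (∏ i ∈ Finset.range k, f (-((i : ℤ) + 1))) *
        ∏ i ∈ Finset.range (n - k), f ((i : ℤ) + 1) := by
  have h1 : (Finset.range (n + 1)).erase k =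
      Finset.range k ∪ (Finset.range (n - k)).map (addLeftEmbedding (k + 1)) := by
    ext j
    simp only [Finset.mem_erase, Finset.mem_range, Finset.mem_union, Finset.mem_map,
      addLeftEmbedding_apply]
    constructor
    · rintro ⟨h, h'⟩
      rcases lt_or_gt_of_ne h with h | h
      · exact Or.inl h
      · exact Or.inr ⟨j - (k + 1), by omega, by omega⟩
    · rintro (h | ⟨a, h, rfl⟩) <;> omega
  rw [h1, Finset.prod_union, Finset.prod_map]
  · congr 1
    · rw [← Finset.prod_range_reflect]
      refine Finset.prod_congr rfl fun i hi => ?_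
      rw [Finset.mem_range] at hi
      congr 1
      omega
    · refine Finset.prod_congr rfl fun i hi => ?_
      congr 1
      simp only [addLeftEmbedding_apply]
      push_cast
      ring
  · rw [Finset.disjoint_left]
    intro j hj
    simp only [Finset.mem_range, Finset.mem_map, addLeftEmbedding_apply] at hj ⊢
    rintro ⟨a, _, rfl⟩
    omega

lemma prod_mul_cofac {n k : ℕ} (hk : k ≤ n) :
    (∏ j ∈ (Finset.range (n + 1)).erase k,
      (PowerSeries.X + PowerSeries.C ((j : ℚ) - k))) * cofac n k = 1 := by
  have h := range_succ_erase_prod hk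
    (fun z : ℤ => (PowerSeries.X : ℚ⟦X⟧) + PowerSeries.C (z : ℚ))
  push_cast at h
  rw [h, cofac, mul_mul_mul_comm, ← Finset.prod_mul_distrib, ← Finset.prod_mul_distrib]
  rw [Finset.prod_eq_one, Finset.prod_eq_one, one_mul]
  · intro i _
    exact X_add_C_mul_invLin (by positivity)
  · intro i _
    refine X_add_C_mul_invLin ?_
    have : (0 : ℚ) < i + 1 := by positivity
    linarith

lemma factorial_mul_cofac_mem {n d k : ℕ} (hd : ∀ l, 1 ≤ l → l ≤ n → l ∣ d) (hk : k ≤ n) :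
    PowerSeries.C (n ! : ℚ) * cofac n k ∈ clearedSubring d := by
  have hint (i : ℕ) (hi : i < n) : ∃ z : ℤ, (d : ℚ) / ((i : ℚ) + 1) = z := by
    obtain ⟨z, hz⟩ := int_mul_inv (d := d) (l := i + 1) (by omega) (hd _ (by omega) hi) 1
    exact ⟨z, by rw [← hz]; push_cast; ring⟩
  have h1 : ∏ i ∈ Finset.range k,
      (PowerSeries.C (-((i : ℚ) + 1)) * invLin (-((i : ℚ) + 1))) ∈ clearedSubring d := by
    refine prod_mem fun i hi => C_mul_invLin_mem ?_ ?_
    · have : (0 : ℚ) < i + 1 := by positivity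
      linarith
    · obtain ⟨z, hz⟩ := hint i (by rw [Finset.mem_range] at hi; omega)
      exact ⟨-z, by rw [div_neg, hz]; simp⟩
  have h2 : ∏ i ∈ Finset.range (n - k),
      (PowerSeries.C ((i : ℚ) + 1) * invLin ((i : ℚ) + 1)) ∈ clearedSubring d := by
    refine prod_mem fun i hi => C_mul_invLin_mem (by positivity) ?_
    exact hint i (by rw [Finset.mem_range] at hi; omega)
  have h3 := mul_mem (C_int_mem_clearedSubring d ((-1) ^ k * n.choose k)) (mul_mem h1 h2)
  convert h3 using 1
  rw [Finset.prod_mul_distrib, Finset.prod_mul_distrib, cofac, ← map_prod, ← map_prod]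
  have e1 : ∏ i ∈ Finset.range k, (-((i : ℚ) + 1)) = (-1) ^ k * k ! := by
    rw [Finset.prod_neg, Finset.card_range, ← Finset.prod_range_add_one_eq_factorial]
    push_cast; rfl
  have e2 : ∏ i ∈ Finset.range (n - k), ((i : ℚ) + 1) = (n - k)! := by
    rw [← Finset.prod_range_add_one_eq_factorial]
    push_cast; rfl
  rw [e1, e2, ← Nat.choose_mul_factorial_mul_factorial hk]
  push_cast
  simp only [map_mul, map_pow, map_neg, map_one]
  have : ((-1 : ℚ⟦X⟧) ^ k) * (-1) ^ k = 1 := by rw [← mul_pow]; simp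
  linear_combination (-PowerSeries.C (n.choose k : ℚ) * PowerSeries.C (k ! : ℚ) *
    PowerSeries.C ((n - k)! : ℚ) * ((∏ i ∈ Finset.range k, invLin (-((i : ℚ) + 1))) *
    ∏ i ∈ Finset.range (n - k), invLin ((i : ℚ) + 1))) * this

lemma evalNegHom_cofac {n k : ℕ} (hk : k ≤ n) :
    PowerSeries.evalNegHom (cofac n (n - k)) = (-1) ^ n * cofac n k := by
  rw [cofac, cofac, map_mul, map_prod, map_prod, Nat.sub_sub_self hk]
  simp only [evalNegHom_invLin, neg_neg, Finset.prod_neg, Finset.card_range]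
  have : (-1 : ℚ⟦X⟧) ^ n = (-1) ^ (n - k) * (-1) ^ k := by rw [← pow_add, Nat.sub_add_cancel hk]
  rw [this]
  ring

/-- The expansion of the rational function
`n!^(σ - Q) D⁻¹ ∏_{j ≤ Q n} (D (t - r n) + j) / ∏_{j ≤ n} (t + j)^σ`, where `Q = (2 r + 1) D`,
multiplied by `(t + k) ^ σ`, at the point `t = -k`. -/
noncomputable def localExp (D r σ n k : ℕ) : ℚ⟦X⟧ :=
  PowerSeries.C ((n ! : ℚ) ^ σ / ((n ! : ℚ) ^ ((2 * r + 1) * D) * D)) *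
    block D ((2 * r + 1) * D * n + 1) (-(((k : ℤ) + r * n) * D)) * cofac n k ^ σ

variable {D r σ n k d : ℕ}

lemma localExp_mem (hD : 0 < D) (hd : ∀ l, 1 ≤ l → l ≤ n → l ∣ d) (hk : k ≤ n) :
    localExp D r σ n k ∈ clearedSubring d := by
  have hD' : (D : ℚ) ≠ 0 := by positivity
  have h1 := block_mul_div_factorial_pow_mem hd D ((2 * r + 1) * D) (-(((k : ℤ) + r * n) * D))
  have h2 := pow_mem (factorial_mul_cofac_mem hd hk) σ
  have h3 : PowerSeries.X + PowerSeries.C (((r + 1) * n - k : ℤ) : ℚ) ∈ clearedSubring d := by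
    refine add_mem ?_ (C_int_mem_clearedSubring d _)
    simpa using C_mul_X_mem_clearedSubring (d := d) (x := 1) ⟨d, by simp⟩
  convert mul_mem (mul_mem h1 h2) h3 using 1
  rw [localExp, block_succ_right, mul_pow]
  have e1 : PowerSeries.C (D : ℚ) * PowerSeries.X +
      PowerSeries.C (((-(((k : ℤ) + r * n) * D) : ℤ) : ℚ) + ((2 * r + 1) * D * n : ℕ)) =
      PowerSeries.C (D : ℚ) *
        (PowerSeries.X + PowerSeries.C (((r + 1) * n - k : ℤ) : ℚ)) := by
    rw [mul_add, ← map_mul]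
    congr 2
    push_cast
    ring
  have e2 : PowerSeries.C ((n ! : ℚ) ^ σ / ((n ! : ℚ) ^ ((2 * r + 1) * D) * D)) *
      PowerSeries.C (D : ℚ) = PowerSeries.C (1 / (n ! : ℚ) ^ ((2 * r + 1) * D)) *
        PowerSeries.C (n ! : ℚ) ^ σ := by
    rw [← map_mul, ← map_pow, ← map_mul]
    congr 1
    field_simp
  rw [e1]
  generalize PowerSeries.X + PowerSeries.C (((r + 1) * n - k : ℤ) : ℚ) = Y
  generalize block D ((2 * r + 1) * D * n) (-(((k : ℤ) + r * n) * D)) = B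
  linear_combination (B * Y * cofac n k ^ σ) * e2

/-- At a zero `x` of the numerator, the local expansion is divisible by `X - x`. -/
lemma exists_localExp_eq_mul (hD : 0 < D) (hd : ∀ l, 1 ≤ l → l ≤ n → l ∣ d) (hk : k ≤ n)
    {x : ℕ} (hx0 : 0 < x) (hx : x ≤ k * D) :
    ∃ g : ℚ⟦X⟧, PowerSeries.C (d : ℚ) * g ∈ clearedSubring d ∧
      localExp D r σ n k = (PowerSeries.X - PowerSeries.C ((x : ℚ) / D)) * g := by
  have hD' : (D : ℚ) ≠ 0 := by positivity
  obtain ⟨j, hj⟩ : ∃ j, j + x = (k + r * n) * D := ⟨(k + r * n) * D - x, by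
    have : x ≤ (k + r * n) * D := hx.trans (Nat.mul_le_mul_right _ (Nat.le_add_right _ _))
    omega⟩
  have hj' : j < (2 * r + 1) * D * n := by
    have : (k + r * n) * D ≤ (2 * r + 1) * D * n := by
      calc (k + r * n) * D ≤ (n + r * n + r * n) * D := Nat.mul_le_mul_right _ (by omega)
        _ = _ := by ring
    omega
  obtain ⟨g, hg, hb⟩ := exists_block_eq_mul hd D ((2 * r + 1) * D)
    (-(((k : ℤ) + r * n) * D)) j hj'
  have h2 := pow_mem (factorial_mul_cofac_mem hd hk) σ
  have h3 : PowerSeries.C (D : ℚ) * PowerSeries.X +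
      PowerSeries.C (((-(((k : ℤ) + r * n) * D) : ℤ) : ℚ) + ((2 * r + 1) * D * n : ℕ)) ∈
        clearedSubring d := by
    refine add_mem ?_ (C_mem_clearedSubring_of_eq
      ⟨-(((k : ℤ) + r * n) * D) + ((2 * r + 1) * D * n : ℕ), by push_cast; rfl⟩)
    exact C_mul_X_mem_clearedSubring ⟨d * D, by push_cast; rfl⟩
  refine ⟨PowerSeries.C ((n ! : ℚ) ^ σ / ((n ! : ℚ) ^ ((2 * r + 1) * D))) * g *
    (PowerSeries.C (D : ℚ) * PowerSeries.X +
      PowerSeries.C (((-(((k : ℤ) + r * n) * D) : ℤ) : ℚ) + ((2 * r + 1) * D * n : ℕ))) *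
    cofac n k ^ σ, ?_, ?_⟩
  · convert mul_mem (mul_mem hg h2) h3 using 1
    rw [mul_pow]
    have e2 : PowerSeries.C (d : ℚ) *
        PowerSeries.C ((n ! : ℚ) ^ σ / ((n ! : ℚ) ^ ((2 * r + 1) * D))) =
        PowerSeries.C ((d : ℚ) / (n ! : ℚ) ^ ((2 * r + 1) * D)) *
        PowerSeries.C (n ! : ℚ) ^ σ := by
      rw [← map_mul, ← map_pow, ← map_mul]
      congr 1
      field_simp
    generalize PowerSeries.C (D : ℚ) * PowerSeries.X +
      PowerSeries.C (((-(((k : ℤ) + r * n) * D) : ℤ) : ℚ) + ((2 * r + 1) * D * n : ℕ)) = Y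
    linear_combination (g * Y * cofac n k ^ σ) * e2
  · rw [localExp, block_succ_right, hb]
    have e1 : PowerSeries.C (D : ℚ) * PowerSeries.X +
        PowerSeries.C (((-(((k : ℤ) + r * n) * D) : ℤ) : ℚ) + j) =
        PowerSeries.C (D : ℚ) * (PowerSeries.X - PowerSeries.C ((x : ℚ) / D)) := by
      rw [mul_sub, ← map_mul, sub_eq_add_neg, ← map_neg]
      congr 2
      have : (j : ℚ) + x = (k + r * n) * D := by exact_mod_cast hj
      push_cast
      field_simp
      linarith
    have e2 : PowerSeries.C ((n ! : ℚ) ^ σ / ((n ! : ℚ) ^ ((2 * r + 1) * D) * D)) *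
        PowerSeries.C (D : ℚ) =
        PowerSeries.C ((n ! : ℚ) ^ σ / ((n ! : ℚ) ^ ((2 * r + 1) * D))) := by
      rw [← map_mul]
      congr 1
      field_simp
    rw [e1]
    generalize PowerSeries.C (D : ℚ) * PowerSeries.X +
      PowerSeries.C (((-(((k : ℤ) + r * n) * D) : ℤ) : ℚ) + ((2 * r + 1) * D * n : ℕ)) = Y
    generalize PowerSeries.X - PowerSeries.C ((x : ℚ) / D) = Z
    linear_combination (Z * g * Y * cofac n k ^ σ) * e2

lemma evalNegHom_block (D a : ℕ) (c : ℤ) :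
    PowerSeries.evalNegHom (block D (a + 1) c) = (-1) ^ (a + 1) * block D (a + 1) (-c - a) := by
  rw [block, block, map_prod, ← Finset.prod_range_reflect]
  have : (-1 : ℚ⟦X⟧) ^ (a + 1) = ∏ i ∈ Finset.range (a + 1), (-1) := by simp
  rw [this, ← Finset.prod_mul_distrib]
  refine Finset.prod_congr rfl fun i hi => ?_
  rw [Finset.mem_range] at hi
  obtain ⟨b, rfl⟩ : ∃ b, a = i + b := ⟨a - i, by omega⟩
  rw [show i + b + 1 - 1 - i = b by omega]
  simp only [map_add, map_mul, evalNegHom_C, PowerSeries.evalNegHom_X]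
  push_cast
  simp only [map_add, map_sub, map_neg]
  ring

lemma evalNegHom_localExp (hD : Even D) (hσ : Even σ) (hk : k ≤ n) :
    PowerSeries.evalNegHom (localExp D r σ n (n - k)) = - localExp D r σ n k := by
  rw [localExp, localExp, map_mul, map_mul, map_pow, evalNegHom_C, evalNegHom_block,
    evalNegHom_cofac hk, mul_pow, ← pow_mul]
  have h1 : Even ((2 * r + 1) * D * n) := (hD.mul_left _).mul_right _
  rw [(hσ.mul_left n).neg_one_pow, pow_succ, h1.neg_one_pow]
  have h2 : -(-((((n - k : ℕ) : ℤ) + r * n) * D)) - (((2 * r + 1) * D * n : ℕ) : ℤ) =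
      -(((k : ℤ) + r * n) * D) := by
    push_cast [hk]
    ring
  rw [h2]
  ring

/-- The coefficients with even index cancel in pairs. -/
lemma sum_coeff_localExp_even (hD : Even D) (hσ : Even σ) {m : ℕ} (hm : Even m) :
    ∑ k ∈ Finset.range (n + 1), PowerSeries.coeff m (localExp D r σ n k) = 0 := by
  have h : ∑ k ∈ Finset.range (n + 1), PowerSeries.coeff m (localExp D r σ n k) =
      - ∑ k ∈ Finset.range (n + 1), PowerSeries.coeff m (localExp D r σ n k) := by
    conv_lhs => rw [← Finset.sum_range_reflect]
    rw [← Finset.sum_neg_distrib]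
    refine Finset.sum_congr rfl fun k hk => ?_
    rw [Finset.mem_range] at hk
    rw [← map_neg, ← evalNegHom_localExp hD hσ (by omega), coeff_evalNegHom, hm.neg_one_pow,
      one_mul, Nat.add_sub_cancel]
  linarith

end OddZeta

namespace OddZeta

section PartialFractions

open Polynomial

variable {n σ : ℕ} {P : ℚ[X]} {F : ℕ → ℚ⟦X⟧}

/-- The numerator over the common denominator `∏_{j ≤ n} (X + j) ^ σ` of the principal part
at `-k` given by the first `σ` coefficients of `f`. -/
noncomputable def principalNum (n σ : ℕ) (f : ℚ⟦X⟧) (k : ℕ) : ℚ[X] :=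
  ∑ m ∈ Finset.range σ, C (PowerSeries.coeff m f) * (X + C (k : ℚ)) ^ m *
    ∏ j ∈ (Finset.range (n + 1)).erase k, (X + C (j : ℚ)) ^ σ

lemma natDegree_prod_erase {k : ℕ} (hk : k ∈ Finset.range (n + 1)) (σ : ℕ) :
    (∏ j ∈ (Finset.range (n + 1)).erase k, (X + C (j : ℚ)) ^ σ).natDegree = n * σ := by
  rw [natDegree_prod_of_monic _ _ fun _ _ => (monic_X_add_C _).pow _]
  simp only [natDegree_pow, natDegree_X_add_C, mul_one, Finset.sum_const,
    Finset.card_erase_of_mem hk, Finset.card_range, smul_eq_mul, Nat.add_sub_cancel]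

lemma monic_prod_erase (n k σ : ℕ) :
    (∏ j ∈ (Finset.range (n + 1)).erase k, (X + C (j : ℚ)) ^ σ).Monic :=
  monic_prod_of_monic _ _ fun _ _ => (monic_X_add_C _).pow _

lemma natDegree_principal_term {k : ℕ} (hk : k ∈ Finset.range (n + 1)) (c : ℚ) (m : ℕ) :
    (C c * (X + C (k : ℚ)) ^ m *
      ∏ j ∈ (Finset.range (n + 1)).erase k, (X + C (j : ℚ)) ^ σ).natDegree ≤ m + n * σ := by
  refine natDegree_mul_le.trans ?_
  rw [natDegree_prod_erase hk]
  gcongr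
  refine (natDegree_C_mul_le _ _).trans ?_
  rw [natDegree_pow, natDegree_X_add_C, mul_one]

lemma dvd_sub_principalNum {k : ℕ}
    (hF : ((P.comp (X - C (k : ℚ)) : ℚ[X]) : ℚ⟦X⟧) = F k *
      (∏ j ∈ (Finset.range (n + 1)).erase k,
        (PowerSeries.X + PowerSeries.C ((j : ℚ) - k))) ^ σ) :
    (X + C (k : ℚ)) ^ σ ∣ P - principalNum n σ (F k) k := by
  set q : ℚ[X] := ∏ j ∈ (Finset.range (n + 1)).erase k, (X + C ((j : ℚ) - k)) with hq
  have hqc : (q : ℚ⟦X⟧) = ∏ j ∈ (Finset.range (n + 1)).erase k,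
      (PowerSeries.X + PowerSeries.C ((j : ℚ) - k)) := by
    have := map_prod (Polynomial.coeToPowerSeries.ringHom (R := ℚ))
      (fun j : ℕ => X + C ((j : ℚ) - k)) ((Finset.range (n + 1)).erase k)
    simp only [Polynomial.coeToPowerSeries.ringHom_apply] at this
    rw [hq, this]
    refine Finset.prod_congr rfl fun j _ => ?_
    rw [Polynomial.coe_add, Polynomial.coe_X, Polynomial.coe_C]
  have h1 : (P - principalNum n σ (F k) k).comp (X - C (k : ℚ)) =
      P.comp (X - C (k : ℚ)) - PowerSeries.trunc σ (F k) * q ^ σ := by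
    rw [sub_comp, principalNum, ← Finset.sum_mul, mul_comp, prod_comp]
    congr 2
    · rw [← coe_compRingHom_apply, map_sum]
      simp only [coe_compRingHom_apply, mul_comp, C_comp, pow_comp, add_comp, X_comp,
        sub_add_cancel]
      ext i
      simp only [finsetSum_coeff, coeff_C_mul_X_pow, PowerSeries.coeff_trunc, Finset.sum_ite_eq,
        Finset.mem_range]
    · rw [hq, ← Finset.prod_pow]
      refine Finset.prod_congr rfl fun j _ => ?_
      simp only [pow_comp, add_comp, X_comp, C_comp, map_sub]
      ring
  have h2 : X ^ σ ∣ (P - principalNum n σ (F k) k).comp (X - C (k : ℚ)) := by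
    rw [h1, Polynomial.X_pow_dvd_iff]
    intro i hi
    rw [← Polynomial.coeff_coe]
    revert i
    rw [← PowerSeries.X_pow_dvd_iff, Polynomial.coe_sub, hF, Polynomial.coe_mul, Polynomial.coe_pow,
      hqc, ← sub_mul]
    refine Dvd.dvd.mul_right ?_ _
    rw [PowerSeries.X_pow_dvd_iff]
    intro i hi
    rw [map_sub, Polynomial.coeff_coe, PowerSeries.coeff_trunc, if_pos hi, sub_self]
  obtain ⟨g, hg⟩ := h2
  refine ⟨g.comp (X + C (k : ℚ)), ?_⟩
  have h3 := congrArg (fun f => f.comp (X + C (k : ℚ))) hg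
  simpa [comp_assoc, mul_comp] using h3

lemma eq_sum_principalNum (hσ : 0 < σ) (hP : P.natDegree < (n + 1) * σ)
    (hF : ∀ k ∈ Finset.range (n + 1), ((P.comp (X - C (k : ℚ)) : ℚ[X]) : ℚ⟦X⟧) = F k *
      (∏ j ∈ (Finset.range (n + 1)).erase k,
        (PowerSeries.X + PowerSeries.C ((j : ℚ) - k))) ^ σ) :
    P = ∑ k ∈ Finset.range (n + 1), principalNum n σ (F k) k := by
  rw [← sub_eq_zero]
  have hdvd : ∏ k ∈ Finset.range (n + 1), (X + C (k : ℚ)) ^ σ ∣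
      P - ∑ k ∈ Finset.range (n + 1), principalNum n σ (F k) k := by
    refine Finset.prod_dvd_of_coprime ?_ fun k hk => ?_
    · intro i _ j _ hij
      refine IsCoprime.pow ?_
      have := pairwise_coprime_X_sub_C (K := ℚ) (s := fun i : ℕ => -(i : ℚ))
        (fun a b h => by simpa using h) hij
      simpa [Function.onFun] using this
    · rw [← Finset.add_sum_erase _ _ hk, ← sub_sub]
      refine dvd_sub (dvd_sub_principalNum (hF k hk)) ?_
      refine Finset.dvd_sum fun l hl => ?_
      rw [Finset.mem_erase] at hl
      refine Finset.dvd_sum fun m _ => Dvd.dvd.mul_left ?_ _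
      exact Finset.dvd_prod_of_mem (fun j : ℕ => (X + C (j : ℚ)) ^ σ)
        (Finset.mem_erase.2 ⟨hl.1.symm, hk⟩)
  refine Polynomial.eq_zero_of_dvd_of_natDegree_lt hdvd ?_
  have hprod : (∏ k ∈ Finset.range (n + 1), (X + C (k : ℚ)) ^ σ).natDegree = (n + 1) * σ := by
    rw [natDegree_prod_of_monic _ _ fun _ _ => (monic_X_add_C _).pow _]
    simp only [natDegree_pow, natDegree_X_add_C, mul_one, Finset.sum_const, Finset.card_range,
      smul_eq_mul]
  rw [hprod]
  have hle : (∑ k ∈ Finset.range (n + 1), principalNum n σ (F k) k).natDegree ≤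
      (n + 1) * σ - 1 := by
    refine natDegree_sum_le_of_forall_le _ _ fun k hk => ?_
    refine natDegree_sum_le_of_forall_le _ _ fun m hm => ?_
    refine (natDegree_principal_term hk _ _).trans ?_
    rw [Finset.mem_range] at hm
    rw [add_mul, one_mul]
    omega
  have := natDegree_sub_le P (∑ k ∈ Finset.range (n + 1), principalNum n σ (F k) k)
  have h0 : 0 < (n + 1) * σ := by positivity
  omega

lemma sum_coeff_eq_zero_of_eq_sum (hσ : 0 < σ) (hP : P.natDegree + 1 < (n + 1) * σ)
    (h : P = ∑ k ∈ Finset.range (n + 1), principalNum n σ (F k) k) :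
    ∑ k ∈ Finset.range (n + 1), PowerSeries.coeff (σ - 1) (F k) = 0 := by
  have h1 : P.coeff (σ - 1 + n * σ) = 0 := by
    refine coeff_eq_zero_of_natDegree_lt ?_
    rw [add_mul, one_mul] at hP
    omega
  rw [h, finsetSum_coeff] at h1
  rw [← h1]
  refine Finset.sum_congr rfl fun k hk => ?_
  rw [principalNum, finsetSum_coeff, Finset.sum_eq_single_of_mem (σ - 1)
    (Finset.mem_range.2 (by omega))]
  · rw [mul_assoc, coeff_C_mul]
    have hm : ((X + C (k : ℚ)) ^ (σ - 1) *
        ∏ j ∈ (Finset.range (n + 1)).erase k, (X + C (j : ℚ)) ^ σ).Monic :=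
      ((monic_X_add_C _).pow _).mul (monic_prod_erase _ _ _)
    have hd : ((X + C (k : ℚ)) ^ (σ - 1) *
        ∏ j ∈ (Finset.range (n + 1)).erase k, (X + C (j : ℚ)) ^ σ).natDegree =
          σ - 1 + n * σ := by
      rw [((monic_X_add_C _).pow _).natDegree_mul (monic_prod_erase _ _ _),
        natDegree_prod_erase hk, natDegree_pow, natDegree_X_add_C, mul_one]
    rw [← hd, coeff_natDegree, hm.leadingCoeff, mul_one]
  · intro m hm hne
    rw [Finset.mem_range] at hm
    refine coeff_eq_zero_of_natDegree_lt ((natDegree_principal_term hk _ _).trans_lt ?_)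
    omega

lemma eval_div_eq_sum (h : P = ∑ k ∈ Finset.range (n + 1), principalNum n σ (F k) k)
    {t : ℚ} (ht : ∀ j ∈ Finset.range (n + 1), t + j ≠ 0) :
    P.eval t / ∏ j ∈ Finset.range (n + 1), (t + j) ^ σ =
      ∑ k ∈ Finset.range (n + 1), ∑ m ∈ Finset.range σ,
        PowerSeries.coeff m (F k) / (t + k) ^ (σ - m) := by
  conv_lhs => rw [h]
  rw [eval_finsetSum, Finset.sum_div]
  refine Finset.sum_congr rfl fun k hk => ?_
  rw [principalNum, eval_finsetSum, Finset.sum_div]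
  refine Finset.sum_congr rfl fun m hm => ?_
  rw [Finset.mem_range] at hm
  have hk0 := ht k hk
  have hp : ∏ j ∈ (Finset.range (n + 1)).erase k, (t + j) ^ σ ≠ 0 :=
    Finset.prod_ne_zero_iff.2 fun j hj => pow_ne_zero _ (ht j (Finset.mem_of_mem_erase hj))
  rw [← Finset.mul_prod_erase _ _ hk, eval_mul, eval_mul, eval_prod]
  simp only [eval_C, eval_pow, eval_add, eval_X]
  rw [div_eq_div_iff (mul_ne_zero (pow_ne_zero _ hk0) hp) (pow_ne_zero _ hk0)]
  have : (t + k) ^ σ = (t + k) ^ m * (t + k) ^ (σ - m) := by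
    rw [← pow_add]; congr 1; omega
  rw [this]
  ring

end PartialFractions

/-- The value at `t = q / D` of the rational function
`n!^(σ - Q) D⁻¹ ∏_{j ≤ Q n} (D (t - r n) + j) / ∏_{j ≤ n} (t + j)^σ`, where `Q = (2 r + 1) D`. -/
def term (D r σ n q : ℕ) : ℚ :=
  (n ! : ℚ) ^ σ / ((n ! : ℚ) ^ ((2 * r + 1) * D) * D) *
    (∏ j ∈ Finset.range ((2 * r + 1) * D * n + 1), ((q : ℚ) - r * n * D + j)) /
      ∏ j ∈ Finset.range (n + 1), ((q : ℚ) / D + j) ^ σ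

/-- The numerator polynomial of the rational function evaluated in `term`. -/
noncomputable def numPoly (D r σ n : ℕ) : Polynomial ℚ :=
  Polynomial.C ((n ! : ℚ) ^ σ / ((n ! : ℚ) ^ ((2 * r + 1) * D) * D)) *
    ∏ j ∈ Finset.range ((2 * r + 1) * D * n + 1),
      (Polynomial.C (D : ℚ) * Polynomial.X + Polynomial.C (j - (r : ℚ) * n * D))

variable {D r σ n : ℕ}

lemma natDegree_numPoly_le (D r σ n : ℕ) :
    (numPoly D r σ n).natDegree ≤ (2 * r + 1) * D * n + 1 := by
  refine (Polynomial.natDegree_C_mul_le _ _).trans ((Polynomial.natDegree_prod_le _ _).trans ?_)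
  refine (Finset.sum_le_sum fun j _ => Polynomial.natDegree_linear_le).trans ?_
  simp

lemma coe_comp_numPoly {k : ℕ} (hk : k ∈ Finset.range (n + 1)) :
    (((numPoly D r σ n).comp (Polynomial.X - Polynomial.C (k : ℚ)) : Polynomial ℚ) : ℚ⟦X⟧) =
      localExp D r σ n k * (∏ j ∈ (Finset.range (n + 1)).erase k,
        (PowerSeries.X + PowerSeries.C ((j : ℚ) - k))) ^ σ := by
  have h := prod_mul_cofac (Nat.lt_succ_iff.1 (Finset.mem_range.1 hk))
  rw [localExp, mul_assoc, ← mul_pow, mul_comm (cofac n k), h, one_pow, mul_one, numPoly,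
    Polynomial.mul_comp, Polynomial.prod_comp, Polynomial.coe_mul, Polynomial.C_comp,
    Polynomial.coe_C, block]
  congr 1
  have := map_prod (Polynomial.coeToPowerSeries.ringHom (R := ℚ))
    (fun j : ℕ => (Polynomial.C (D : ℚ) * Polynomial.X +
      Polynomial.C (j - (r : ℚ) * n * D)).comp (Polynomial.X - Polynomial.C (k : ℚ)))
    (Finset.range ((2 * r + 1) * D * n + 1))
  simp only [Polynomial.coeToPowerSeries.ringHom_apply] at this
  rw [this]
  refine Finset.prod_congr rfl fun j _ => ?_
  simp only [Polynomial.add_comp, Polynomial.mul_comp, Polynomial.C_comp, Polynomial.X_comp,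
    Polynomial.coe_add, Polynomial.coe_sub, Polynomial.coe_mul, Polynomial.coe_C, Polynomial.coe_X]
  push_cast
  simp only [map_add, map_sub, map_mul, map_neg]
  ring

lemma numPoly_eq_sum (hσ : 0 < σ) (h : (2 * r + 1) * D * n + 1 < (n + 1) * σ) :
    numPoly D r σ n = ∑ k ∈ Finset.range (n + 1), principalNum n σ (localExp D r σ n k) k :=
  eq_sum_principalNum hσ ((natDegree_numPoly_le _ _ _ _).trans_lt h)
    fun _ hk => coe_comp_numPoly hk

lemma term_eq_sum (hD : 0 < D) (hσ : 0 < σ) (h : (2 * r + 1) * D * n + 1 < (n + 1) * σ)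
    {q : ℕ} (hq : 0 < q) :
    term D r σ n q = ∑ k ∈ Finset.range (n + 1), ∑ m ∈ Finset.range σ,
      PowerSeries.coeff m (localExp D r σ n k) / ((q : ℚ) / D + k) ^ (σ - m) := by
  rw [← eval_div_eq_sum (numPoly_eq_sum hσ h) (fun j _ => by positivity), term, numPoly,
    Polynomial.eval_mul, Polynomial.eval_C, Polynomial.eval_prod]
  congr 2
  refine Finset.prod_congr rfl fun j _ => ?_
  have : (D : ℚ) ≠ 0 := by positivity
  simp only [Polynomial.eval_add, Polynomial.eval_mul, Polynomial.eval_C, Polynomial.eval_X]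
  field_simp
  ring

lemma sum_residues_eq_zero (hσ : 0 < σ) (h : (2 * r + 1) * D * n + 2 < (n + 1) * σ) :
    ∑ k ∈ Finset.range (n + 1), PowerSeries.coeff (σ - 1) (localExp D r σ n k) = 0 :=
  sum_coeff_eq_zero_of_eq_sum (F := localExp D r σ n) hσ
    (by have := natDegree_numPoly_le D r σ n; omega) (numPoly_eq_sum hσ (by omega))

lemma sum_coeff_mul_pow_of_eq_mul {f g : ℚ⟦X⟧} {x : ℚ}
    (h : f = (PowerSeries.X - PowerSeries.C x) * g) (N : ℕ) :
    ∑ m ∈ Finset.range (N + 1), PowerSeries.coeff m f * x ^ m =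
      -(x ^ (N + 1) * PowerSeries.coeff N g) := by
  induction N with
  | zero => simp [h, sub_mul]
  | succ N ih =>
    rw [Finset.sum_range_succ, ih, h, sub_mul, map_sub, PowerSeries.coeff_succ_X_mul,
      PowerSeries.coeff_C_mul]
    ring

/-- At a zero of the numerator the sum of the principal parts has a small denominator. -/
lemma exists_int_principal_eval (hD : 0 < D) (hσ : 0 < σ) {d : ℕ}
    (hd : ∀ l, 1 ≤ l → l ≤ n → l ∣ d) {k : ℕ} (hk : k ≤ n) {x : ℕ} (hx0 : 0 < x)
    (hx : x ≤ k * D) :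
    ∃ z : ℤ, (d : ℚ) ^ σ * ∑ m ∈ Finset.range σ,
      PowerSeries.coeff m (localExp D r σ n k) / ((x : ℚ) / D) ^ (σ - m) = z := by
  obtain ⟨g, hg, hf⟩ := exists_localExp_eq_mul (r := r) (σ := σ) hD hd hk hx0 hx
  obtain ⟨N, rfl⟩ : ∃ N, σ = N + 1 := ⟨σ - 1, by omega⟩
  have hy : ((x : ℚ) / D) ≠ 0 := by positivity
  have h1 := sum_coeff_mul_pow_of_eq_mul hf N
  have h2 : ∑ m ∈ Finset.range (N + 1), PowerSeries.coeff m (localExp D r (N + 1) n k) /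
      ((x : ℚ) / D) ^ (N + 1 - m) = - PowerSeries.coeff N g := by
    rw [← mul_right_inj' (pow_ne_zero (N + 1) hy), mul_neg, ← h1, Finset.mul_sum]
    refine Finset.sum_congr rfl fun m hm => ?_
    rw [Finset.mem_range] at hm
    have : ((x : ℚ) / D) ^ (N + 1) = ((x : ℚ) / D) ^ m * ((x : ℚ) / D) ^ (N + 1 - m) := by
      rw [← pow_add]; congr 1; omega
    rw [this]
    generalize hY : ((x : ℚ) / D) ^ (N + 1 - m) = Y
    have hY0 : Y ≠ 0 := hY ▸ pow_ne_zero _ hy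
    field_simp
  obtain ⟨z, hz⟩ := (mem_clearedSubring.1 hg) N
  refine ⟨-z, ?_⟩
  rw [h2]
  push_cast
  rw [← hz, PowerSeries.coeff_C_mul]
  ring

end OddZeta

namespace OddZeta

open Filter Topology

variable {D r σ n : ℕ}

lemma hasSum_shift_one_sub {f : ℕ → ℝ} (hf : Antitone f) (h0 : Tendsto f atTop (𝓝 0)) :
    HasSum (fun p => f (p + 1) - f p) (-f 0) := by
  have h : HasSum (fun p => f p - f (p + 1)) (f 0) := by
    rw [hasSum_iff_tendsto_nat_of_nonneg fun p => sub_nonneg.2 (hf (Nat.le_succ p))]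
    simp_rw [Finset.sum_range_sub']
    simpa using tendsto_const_nhds.sub h0
  simpa using h.neg

lemma hasSum_shift_sub {f : ℕ → ℝ} (hf : Antitone f) (h0 : Tendsto f atTop (𝓝 0)) (N : ℕ) :
    HasSum (fun p => f (p + N) - f p) (-∑ p ∈ Finset.range N, f p) := by
  induction N with
  | zero => simp [hasSum_zero]
  | succ N ih =>
    have h := hasSum_shift_one_sub (f := fun p => f (p + N))
      (fun a b hab => hf (Nat.add_le_add_right hab N)) ((tendsto_add_atTop_iff_nat N).2 h0)
    rw [Finset.sum_range_succ, neg_add]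
    have h2 := ih.add h
    rw [zero_add] at h2
    refine h2.congr_fun ?_
    intro p
    rw [show p + 1 + N = p + (N + 1) by ring]
    ring

/-- The function `p ↦ ((p + 1) / e) ^ (-i)`. -/
noncomputable def zetaTerm (e i p : ℕ) : ℝ := 1 / (((p : ℝ) + 1) / e) ^ i

lemma antitone_zetaTerm {e : ℕ} (he : 0 < e) (i : ℕ) : Antitone (zetaTerm e i) := by
  intro a b hab
  have : (0 : ℝ) < e := by positivity
  unfold zetaTerm
  gcongr

lemma tendsto_zetaTerm {e i : ℕ} (he : 0 < e) (hi : 1 ≤ i) :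
    Tendsto (zetaTerm e i) atTop (𝓝 0) := by
  have he' : (0 : ℝ) < e := by positivity
  unfold zetaTerm
  simp_rw [one_div]
  refine Tendsto.comp tendsto_inv_atTop_zero ((tendsto_pow_atTop (by omega)).comp ?_)
  exact (tendsto_natCast_atTop_atTop.atTop_add tendsto_const_nhds).atTop_div_const he'

lemma hasSum_zetaTerm {e i : ℕ} (hi : 2 ≤ i) :
    HasSum (zetaTerm e i) ((e : ℝ) ^ i * zetaVal i) := by
  have h : Summable fun m : ℕ => 1 / ((m : ℝ) + 1) ^ i := by
    have := (summable_nat_add_iff 1).2 (Real.summable_one_div_nat_pow.2 (show 1 < i by omega))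
    simpa using this
  refine (h.hasSum.mul_left ((e : ℝ) ^ i)).congr_fun fun p => ?_
  rw [zetaTerm, div_pow, one_div_div, mul_one_div]

lemma zetaTerm_add_mul {e : ℕ} (he : 0 < e) (i k p : ℕ) :
    zetaTerm e i (p + e * k) = 1 / (((p : ℝ) + 1) / e + k) ^ i := by
  have he' : (e : ℝ) ≠ 0 := by positivity
  rw [zetaTerm]
  congr 2
  push_cast
  field_simp
  ring

/-- The coefficient of `ζ(i)` in the linear form. -/
noncomputable def zetaCoeff (D r σ n i : ℕ) : ℚ :=
  ∑ k ∈ Finset.range (n + 1), PowerSeries.coeff (σ - i) (localExp D r σ n k)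

lemma exists_int_zetaCoeff (hD : 0 < D) {d : ℕ} (hd : ∀ l, 1 ≤ l → l ≤ n → l ∣ d) (i : ℕ) :
    ∃ z : ℤ, (d : ℚ) ^ σ * zetaCoeff D r σ n i = z := by
  have h : ∀ k, ∃ z : ℤ, k ∈ Finset.range (n + 1) →
      (d : ℚ) ^ σ * PowerSeries.coeff (σ - i) (localExp D r σ n k) = z := by
    intro k
    by_cases hk : k ∈ Finset.range (n + 1)
    · obtain ⟨z, hz⟩ := mem_clearedSubring.1
        (localExp_mem (r := r) (σ := σ) hD hd (Nat.lt_succ_iff.1 (Finset.mem_range.1 hk))) (σ - i)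
      refine ⟨d ^ (σ - (σ - i)) * z, fun _ => ?_⟩
      have : (d : ℚ) ^ σ = d ^ (σ - (σ - i)) * d ^ (σ - i) := by
        rw [← pow_add]; congr 1; omega
      push_cast
      rw [this, ← hz, mul_assoc]
    · exact ⟨0, fun h => absurd h hk⟩
  choose z hz using h
  refine ⟨∑ k ∈ Finset.range (n + 1), z k, ?_⟩
  rw [zetaCoeff, Finset.mul_sum]
  push_cast
  exact Finset.sum_congr rfl fun k hk => hz k hk

/-- The rational constant term of the linear form. -/
noncomputable def constCoeff (D r σ n e : ℕ) : ℚ :=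
  ∑ k ∈ Finset.range (n + 1), ∑ p ∈ Finset.range (e * k), ∑ m ∈ Finset.range σ,
    PowerSeries.coeff m (localExp D r σ n k) / (((p : ℚ) + 1) / e) ^ (σ - m)

lemma exists_int_constCoeff (hD : 0 < D) (hσ : 0 < σ) {d : ℕ}
    (hd : ∀ l, 1 ≤ l → l ≤ n → l ∣ d) {e : ℕ} (he : e ∣ D) :
    ∃ z : ℤ, (d : ℚ) ^ σ * constCoeff D r σ n e = z := by
  obtain ⟨h, rfl⟩ := he
  have he0 : 0 < e := Nat.pos_of_mul_pos_right hD
  have hh0 : 0 < h := Nat.pos_of_mul_pos_left hD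
  have key : ∀ k p, ∃ z : ℤ, k ∈ Finset.range (n + 1) → p ∈ Finset.range (e * k) →
      (d : ℚ) ^ σ * ∑ m ∈ Finset.range σ,
        PowerSeries.coeff m (localExp (e * h) r σ n k) / (((p : ℚ) + 1) / e) ^ (σ - m) = z := by
    intro k p
    by_cases hkp : k ∈ Finset.range (n + 1) ∧ p ∈ Finset.range (e * k)
    · obtain ⟨hk, hp⟩ := hkp
      rw [Finset.mem_range] at hk hp
      obtain ⟨z, hz⟩ := exists_int_principal_eval (r := r) (x := (p + 1) * h) hD hσ hd
        (Nat.lt_succ_iff.1 hk) (by positivity)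
        (by calc (p + 1) * h ≤ (e * k) * h := Nat.mul_le_mul_right _ hp
              _ = k * (e * h) := by ring)
      refine ⟨z, fun _ _ => ?_⟩
      rw [← hz]
      have : (((p + 1) * h : ℕ) : ℚ) / ((e * h : ℕ) : ℚ) = ((p : ℚ) + 1) / e := by
        push_cast
        rw [mul_div_mul_right _ _ (by positivity)]
      rw [this]
    · exact ⟨0, fun h1 h2 => absurd ⟨h1, h2⟩ hkp⟩
  choose z hz using key
  refine ⟨∑ k ∈ Finset.range (n + 1), ∑ p ∈ Finset.range (e * k), z k p, ?_⟩
  rw [constCoeff, Finset.mul_sum]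
  push_cast
  refine Finset.sum_congr rfl fun k hk => ?_
  rw [Finset.mul_sum]
  exact Finset.sum_congr rfl fun p hp => hz k p hk hp

lemma hasSum_term (hD : Even D) (hD0 : 0 < D) (hσ : Even σ) (hσ0 : 0 < σ)
    (hdeg : (2 * r + 1) * D * n + 2 < (n + 1) * σ) {e h : ℕ} (heh : e * h = D) :
    HasSum (fun p : ℕ => (term D r σ n ((p + 1) * h) : ℝ))
      (∑ i ∈ (Finset.Icc 3 (σ - 1)).filter Odd,
        (zetaCoeff D r σ n i : ℝ) * (e : ℝ) ^ i * zetaVal i - constCoeff D r σ n e) := by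
  have he0 : 0 < e := Nat.pos_of_mul_pos_right (heh ▸ hD0)
  have hh0 : 0 < h := Nat.pos_of_mul_pos_left (heh ▸ hD0)
  have hterm : ∀ p : ℕ, (term D r σ n ((p + 1) * h) : ℝ) =
      (∑ k ∈ Finset.range (n + 1), ∑ m ∈ Finset.range σ,
        ((PowerSeries.coeff m (localExp D r σ n k) : ℚ) : ℝ) *
          (zetaTerm e (σ - m) (p + e * k) - zetaTerm e (σ - m) p)) +
      ∑ m ∈ Finset.range σ, ((∑ k ∈ Finset.range (n + 1),
        PowerSeries.coeff m (localExp D r σ n k) : ℚ) : ℝ) * zetaTerm e (σ - m) p := by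
    intro p
    rw [term_eq_sum hD0 hσ0 (by omega) (by positivity)]
    push_cast
    simp_rw [Finset.sum_mul]
    rw [Finset.sum_comm (s := Finset.range σ), ← Finset.sum_add_distrib]
    refine Finset.sum_congr rfl fun k _ => ?_
    rw [← Finset.sum_add_distrib]
    refine Finset.sum_congr rfl fun m _ => ?_
    have : ((p : ℝ) + 1) * h / D = ((p : ℝ) + 1) / e := by
      rw [← heh]
      push_cast
      rw [mul_div_mul_right _ _ (by positivity)]
    rw [zetaTerm_add_mul he0, this]
    ring
  have hfirst : HasSum (fun p => ∑ k ∈ Finset.range (n + 1), ∑ m ∈ Finset.range σ,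
        ((PowerSeries.coeff m (localExp D r σ n k) : ℚ) : ℝ) *
          (zetaTerm e (σ - m) (p + e * k) - zetaTerm e (σ - m) p))
      (-(constCoeff D r σ n e : ℝ)) := by
    have : -(constCoeff D r σ n e : ℝ) = ∑ k ∈ Finset.range (n + 1), ∑ m ∈ Finset.range σ,
        ((PowerSeries.coeff m (localExp D r σ n k) : ℚ) : ℝ) *
          (-∑ p ∈ Finset.range (e * k), zetaTerm e (σ - m) p) := by
      rw [constCoeff]
      push_cast
      rw [← Finset.sum_neg_distrib]
      refine Finset.sum_congr rfl fun k _ => ?_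
      simp_rw [mul_neg, Finset.mul_sum]
      rw [Finset.sum_neg_distrib, Finset.sum_comm]
      congr 1
      refine Finset.sum_congr rfl fun m _ => Finset.sum_congr rfl fun p _ => ?_
      rw [zetaTerm, mul_one_div]
    rw [this]
    refine hasSum_sum fun k _ => hasSum_sum fun m hm => ?_
    rw [Finset.mem_range] at hm
    exact (hasSum_shift_sub (antitone_zetaTerm he0 _)
      (tendsto_zetaTerm he0 (by omega)) _).mul_left _
  have hsecond : HasSum (fun p => ∑ m ∈ Finset.range σ, ((∑ k ∈ Finset.range (n + 1),
        PowerSeries.coeff m (localExp D r σ n k) : ℚ) : ℝ) * zetaTerm e (σ - m) p)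
      (∑ m ∈ Finset.range σ, ((∑ k ∈ Finset.range (n + 1),
        PowerSeries.coeff m (localExp D r σ n k) : ℚ) : ℝ) *
          ((e : ℝ) ^ (σ - m) * zetaVal (σ - m))) := by
    refine hasSum_sum fun m hm => ?_
    rw [Finset.mem_range] at hm
    by_cases h1 : m = σ - 1
    · rw [h1, sum_residues_eq_zero hσ0 hdeg]
      simp [hasSum_zero]
    · exact (hasSum_zetaTerm (by omega)).mul_left _
  have hre : ∑ m ∈ Finset.range σ, ((∑ k ∈ Finset.range (n + 1),
        PowerSeries.coeff m (localExp D r σ n k) : ℚ) : ℝ) *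
          ((e : ℝ) ^ (σ - m) * zetaVal (σ - m)) =
      ∑ i ∈ (Finset.Icc 3 (σ - 1)).filter Odd,
        (zetaCoeff D r σ n i : ℝ) * (e : ℝ) ^ i * zetaVal i := by
    rw [← Finset.sum_subset (s₁ := (Finset.range (σ - 2)).filter Odd)]
    · refine Finset.sum_bij' (fun m _ => σ - m) (fun i _ => σ - i) ?_ ?_ ?_ ?_ ?_
      · intro m hm
        simp only [Finset.mem_filter, Finset.mem_range, Finset.mem_Icc] at hm ⊢
        obtain ⟨a, b⟩ := hm.2
        refine ⟨⟨by omega, by omega⟩, Nat.Even.sub_odd (by omega) hσ hm.2⟩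
      · intro i hi
        simp only [Finset.mem_filter, Finset.mem_range, Finset.mem_Icc] at hi ⊢
        exact ⟨by omega, Nat.Even.sub_odd (by omega) hσ hi.2⟩
      · intro m hm
        simp only [Finset.mem_filter, Finset.mem_range] at hm
        omega
      · intro i hi
        simp only [Finset.mem_filter, Finset.mem_Icc] at hi
        omega
      · intro m hm
        simp only [Finset.mem_filter, Finset.mem_range] at hm
        rw [zetaCoeff, show σ - (σ - m) = m by omega, mul_assoc]
    · intro m hm
      simp only [Finset.mem_filter, Finset.mem_range] at hm ⊢
      omega
    · intro m hm hm'
      simp only [Finset.mem_filter, Finset.mem_range, not_and] at hm hm'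
      have h0 : ∑ k ∈ Finset.range (n + 1), PowerSeries.coeff m (localExp D r σ n k) = 0 := by
        rcases Nat.even_or_odd m with hme | hmo
        · exact sum_coeff_localExp_even hD hσ hme
        · have : m = σ - 1 := by
            have h2 : ¬ m < σ - 2 := fun h => hm' h hmo
            obtain ⟨a, ha⟩ := hσ
            obtain ⟨b, hb⟩ := hmo
            omega
          rw [this]
          exact sum_residues_eq_zero hσ0 hdeg
      rw [h0]
      simp
  rw [hre] at hsecond
  rw [sub_eq_neg_add]
  exact (hfirst.add hsecond).congr_fun hterm

end OddZeta

namespace OddZeta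

open Filter Topology

section Variation

variable {a u v : ℕ → ℝ} {c L A lam : ℝ}

lemma sum_mul_sub_le (ha : ∀ i, 0 ≤ a i) (h0 : a 0 = 0) (hv : Monotone v)
    (hu : ∀ i, u (i + 1) - u i ≤ L) (N : ℕ) :
    ∑ i ∈ Finset.range N, (v i - u i) * (a (i + 1) - a i) ≤
      (v N - u N) * a N + L * ∑ i ∈ Finset.range N, a (i + 1) := by
  induction N with
  | zero => simp [h0]
  | succ N ih =>
    rw [Finset.sum_range_succ, Finset.sum_range_succ]
    have h1 : 0 ≤ (L - (u (N + 1) - u N) + (v (N + 1) - v N)) * a (N + 1) :=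
      mul_nonneg (by linarith [hu N, hv (Nat.le_succ N)]) (ha _)
    linarith

/-- If the ratio of consecutive terms is `v / u` with `u` slowly varying and `v` increasing, then
the total variation is small compared to the sum. -/
lemma sum_abs_sub_le (ha : ∀ i, 0 ≤ a i) (h0 : a 0 = 0) (hA : HasSum (fun i => a (i + 1)) A)
    (huv : ∀ i, u i * a (i + 1) = v i * a i) (hc : 0 < c) (hcv : ∀ i, c ≤ v i)
    (hv1 : ∀ i, v i ≤ 1) (hv : Monotone v) (hu0 : ∀ i, 0 ≤ u i) (hL : 0 ≤ L)
    (hu : ∀ i, u (i + 1) - u i ≤ L) (hlam : 0 < lam) (N : ℕ) :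
    ∑ i ∈ Finset.range N, |a (i + 1) - a i| ≤ (lam * L + 1 / (lam * c)) / 2 * A := by
  have hpoint : ∀ i, |a (i + 1) - a i| ≤
      (lam * ((v i - u i) * (a (i + 1) - a i)) + 1 / (lam * c) * a (i + 1)) / 2 := by
    intro i
    have hvi : 0 < v i := hc.trans_le (hcv i)
    have hΔ : a (i + 1) - a i = (v i - u i) * (a (i + 1) / v i) := by
      field_simp
      linarith [huv i]
    have hx : 0 ≤ a (i + 1) / v i := div_nonneg (ha _) hvi.le
    rw [hΔ, abs_mul, abs_of_nonneg hx]
    have h1 : a (i + 1) / v i ≤ a (i + 1) / c := by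
      have := ha (i + 1)
      gcongr
      exact hcv i
    have h2 : 1 / (lam * c) * a (i + 1) = 1 / lam * (a (i + 1) / c) := by field_simp
    rw [h2]
    have h3 : 1 / lam * (a (i + 1) / v i) ≤ 1 / lam * (a (i + 1) / c) := by gcongr
    have h4 : |v i - u i| ≤ (lam * (v i - u i) ^ 2 + 1 / lam) / 2 := by
      have h5 : 0 ≤ (lam * |v i - u i| - 1) ^ 2 / lam := by positivity
      have h6 : (lam * |v i - u i| - 1) ^ 2 / lam =
          lam * (v i - u i) ^ 2 + 1 / lam - 2 * |v i - u i| := by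
        rw [← sq_abs (v i - u i)]
        field_simp
        ring
      linarith
    have h7 := mul_le_mul_of_nonneg_right h4 hx
    nlinarith
  have hbound : ∀ N, ∑ i ∈ Finset.range N, |a (i + 1) - a i| ≤
      (lam * (a N + L * A) + 1 / (lam * c) * A) / 2 := by
    intro N
    refine (Finset.sum_le_sum fun i _ => hpoint i).trans ?_
    rw [← Finset.sum_div, Finset.sum_add_distrib, ← Finset.mul_sum, ← Finset.mul_sum]
    have h1 : ∑ i ∈ Finset.range N, a (i + 1) ≤ A :=
      sum_le_hasSum _ (fun i _ => ha _) hA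
    have h2 := sum_mul_sub_le ha h0 hv hu N
    have h3 : (v N - u N) * a N ≤ a N := by
      have : v N - u N ≤ 1 := by linarith [hv1 N, hu0 N]
      nlinarith [ha N]
    have h4 : L * ∑ i ∈ Finset.range N, a (i + 1) ≤ L * A := by gcongr
    have h5 : 1 / (lam * c) * ∑ i ∈ Finset.range N, a (i + 1) ≤ 1 / (lam * c) * A := by gcongr
    gcongr
    linarith
  have hlim : Tendsto (fun N => (lam * (a N + L * A) + 1 / (lam * c) * A) / 2) atTop
      (𝓝 ((lam * (0 + L * A) + 1 / (lam * c) * A) / 2)) := by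
    have h1 : Tendsto a atTop (𝓝 0) :=
      (tendsto_add_atTop_iff_nat 1).1 hA.summable.tendsto_atTop_zero
    exact (((h1.add_const _).const_mul _).add_const _).div_const _
  have : (lam * L + 1 / (lam * c)) / 2 * A = (lam * (0 + L * A) + 1 / (lam * c) * A) / 2 := by
    ring
  rw [this]
  refine ge_of_tendsto hlim (eventually_atTop.2 ⟨N, fun M hM => ?_⟩)
  refine le_trans ?_ (hbound M)
  exact Finset.sum_le_sum_of_subset_of_nonneg (Finset.range_mono hM) fun _ _ _ => abs_nonneg _

lemma abs_block_sum_sub_le (a : ℕ → ℝ) (h N : ℕ) :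
    |h * ∑ p ∈ Finset.range N, a ((p + 1) * h) - ∑ q ∈ Finset.range (N * h), a (q + 1)| ≤
      h * ∑ q ∈ Finset.range (N * h), |a (q + 1) - a q| := by
  induction N with
  | zero => simp
  | succ N ih =>
    have hlast : |h * a ((N + 1) * h) - ∑ t ∈ Finset.range h, a (N * h + t + 1)| ≤
        h * ∑ t ∈ Finset.range h, |a (N * h + t + 1) - a (N * h + t)| := by
      have h1 : h * a ((N + 1) * h) - ∑ t ∈ Finset.range h, a (N * h + t + 1) =
          ∑ t ∈ Finset.range h, (a ((N + 1) * h) - a (N * h + t + 1)) := by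
        rw [Finset.sum_sub_distrib]
        simp
      rw [h1]
      refine (Finset.abs_sum_le_sum_abs _ _).trans ?_
      have h2 : ∀ t ∈ Finset.range h, |a ((N + 1) * h) - a (N * h + t + 1)| ≤
          ∑ t ∈ Finset.range h, |a (N * h + t + 1) - a (N * h + t)| := by
        intro t ht
        rw [Finset.mem_range] at ht
        have h3 := dist_le_Ico_sum_dist a (m := N * h + t + 1) (n := (N + 1) * h)
          (by rw [add_mul]; omega)
        rw [dist_comm, Real.dist_eq] at h3
        refine h3.trans ?_
        have h4 : ∑ t ∈ Finset.range h, |a (N * h + t + 1) - a (N * h + t)| =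
            ∑ q ∈ Finset.Ico (N * h) ((N + 1) * h), dist (a q) (a (q + 1)) := by
          rw [Finset.sum_Ico_eq_sum_range, add_mul, one_mul, Nat.add_sub_cancel_left]
          exact Finset.sum_congr rfl fun q _ => by rw [dist_comm, Real.dist_eq]
        rw [h4]
        exact Finset.sum_le_sum_of_subset_of_nonneg
          (Finset.Ico_subset_Ico_left (by omega)) fun _ _ _ => dist_nonneg
      refine (Finset.sum_le_sum h2).trans ?_
      simp
    rw [Finset.sum_range_succ, add_mul, one_mul, Finset.sum_range_add, Finset.sum_range_add,
      mul_add, mul_add]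
    rw [add_mul, one_mul] at hlast
    refine le_trans ?_ (add_le_add ih hlast)
    rw [add_sub_add_comm]
    exact abs_add_le _ _

lemma abs_mul_sub_le {a : ℕ → ℝ} {A B S : ℝ} {h : ℕ} (hh : 0 < h)
    (hA : HasSum (fun q => a (q + 1)) A) (hS : HasSum (fun p => a ((p + 1) * h)) S)
    (hB : ∀ N, ∑ q ∈ Finset.range N, |a (q + 1) - a q| ≤ B) : |h * S - A| ≤ h * B := by
  have h1 : Tendsto (fun N => |h * ∑ p ∈ Finset.range N, a ((p + 1) * h) -
      ∑ q ∈ Finset.range (N * h), a (q + 1)|) atTop (𝓝 |h * S - A|) := by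
    refine ((hS.tendsto_sum_nat.const_mul _).sub (hA.tendsto_sum_nat.comp ?_)).abs
    exact tendsto_id.atTop_mul_const' hh
  refine le_of_tendsto h1 (Eventually.of_forall fun N => (abs_block_sum_sub_le a h N).trans ?_)
  gcongr
  exact hB _

end Variation

end OddZeta

namespace OddZeta

open Filter Topology

variable {D r σ n : ℕ}

lemma cast_term_add (D r σ n i : ℕ) : (term D r σ n (r * n * D + i) : ℝ) =
    (n ! : ℝ) ^ σ / ((n ! : ℝ) ^ ((2 * r + 1) * D) * D) *
      (∏ j ∈ Finset.range ((2 * r + 1) * D * n + 1), ((i : ℝ) + j)) /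
        ∏ j ∈ Finset.range (n + 1), (((r * n * D + i : ℕ) : ℝ) / D + j) ^ σ := by
  rw [term]
  push_cast
  congr 2
  refine Finset.prod_congr rfl fun j _ => ?_
  ring

lemma term_eq_zero {q : ℕ} (hq : q ≤ r * n * D) : term D r σ n q = 0 := by
  have : ∏ j ∈ Finset.range ((2 * r + 1) * D * n + 1), ((q : ℚ) - r * n * D + j) = 0 := by
    refine Finset.prod_eq_zero (i := r * n * D - q) (Finset.mem_range.2 ?_) ?_
    · have : r * n * D ≤ (2 * r + 1) * D * n := by nlinarith [Nat.zero_le (r * n * D), Nat.zero_le (D * n)]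
      omega
    · push_cast [hq]
      ring
  rw [term, this, mul_zero, zero_div]

lemma cast_term_add_nonneg (D r σ n i : ℕ) : (0 : ℝ) ≤ term D r σ n (r * n * D + i) := by
  rw [cast_term_add]
  positivity

lemma cast_term_nonneg (D r σ n q : ℕ) : (0 : ℝ) ≤ term D r σ n q := by
  rcases le_or_gt q (r * n * D) with h | h
  · rw [term_eq_zero h, Rat.cast_zero]
  · obtain ⟨i, rfl⟩ := Nat.exists_eq_add_of_lt h
    rw [add_assoc]
    exact cast_term_add_nonneg _ _ _ _ _

lemma cast_term_add_succ_pos (hD : 0 < D) (r σ n i : ℕ) :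
    (0 : ℝ) < term D r σ n (r * n * D + (i + 1)) := by
  rw [cast_term_add]
  have : (0 : ℝ) < D := by positivity
  push_cast
  positivity

/-- The factor by which the denominator of `term` changes from `r n D + i` to `r n D + i + 1`. -/
noncomputable def denomRatio (D r σ n i : ℕ) : ℝ :=
  ∏ j ∈ Finset.range (n + 1), (1 - 1 / ((r * n * D + i + 1 + j * D : ℕ) : ℝ)) ^ σ

lemma term_recurrence (hD : 0 < D) (hr : 0 < r) (hn : 0 < n) (i : ℕ) :
    (i : ℝ) / (i + ((2 * r + 1) * D * n + 1 : ℕ)) * term D r σ n (r * n * D + (i + 1)) =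
      denomRatio D r σ n i * term D r σ n (r * n * D + i) := by
  have hD' : (0 : ℝ) < D := by positivity
  set M := (2 * r + 1) * D * n + 1 with hM
  have hnum : (i : ℝ) * ∏ j ∈ Finset.range M, (((i + 1 : ℕ) : ℝ) + j) =
      (∏ j ∈ Finset.range M, ((i : ℝ) + j)) * (i + M) := by
    rw [← Finset.prod_range_succ (fun j : ℕ => (i : ℝ) + j) M,
      Finset.prod_range_succ' (fun j : ℕ => (i : ℝ) + j) M, mul_comm]
    simp only [Nat.cast_add, Nat.cast_one, Nat.cast_zero, add_zero]
    congr 1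
    refine Finset.prod_congr rfl fun j _ => ?_
    ring
  set P : ℕ → ℝ := fun i => ∏ j ∈ Finset.range (n + 1), (((r * n * D + i : ℕ) : ℝ) / D + j) ^ σ
    with hP
  have hP0 : ∀ i, 0 < P i := fun i => by
    refine Finset.prod_pos fun j _ => pow_pos ?_ _
    positivity
  have hden : denomRatio D r σ n i * P (i + 1) = P i := by
    rw [denomRatio, hP]
    simp only
    rw [← Finset.prod_mul_distrib]
    refine Finset.prod_congr rfl fun j _ => ?_
    rw [← mul_pow]
    congr 1
    have h1 : ((r * n * D + i + 1 + j * D : ℕ) : ℝ) ≠ 0 := by positivity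
    field_simp
    push_cast
    ring
  rw [cast_term_add, cast_term_add, ← hM]
  change _ * (_ / P (i + 1)) = _ * (_ / P i)
  have h1 := (hP0 i).ne'
  have h2 := (hP0 (i + 1)).ne'
  have h3 : (i : ℝ) + M ≠ 0 := by positivity
  have h4 : denomRatio D r σ n i = P i / P (i + 1) := by rw [← hden]; field_simp
  rw [h4]
  generalize (n ! : ℝ) ^ σ / ((n ! : ℝ) ^ ((2 * r + 1) * D) * D) = C
  generalize (∏ j ∈ Finset.range M, (((i + 1 : ℕ) : ℝ) + j)) = X at *
  generalize (∏ j ∈ Finset.range M, ((i : ℝ) + j)) = Y at *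
  field_simp
  linear_combination C * hnum

lemma one_sub_one_div_nonneg {x : ℕ} : (0 : ℝ) ≤ 1 - 1 / ((x + 1 : ℕ) : ℝ) := by
  rw [sub_nonneg, div_le_one (by positivity)]
  push_cast
  linarith [(Nat.cast_nonneg x : (0 : ℝ) ≤ x)]

lemma denomRatio_factor_nonneg (D r n i j : ℕ) :
    (0 : ℝ) ≤ 1 - 1 / ((r * n * D + i + 1 + j * D : ℕ) : ℝ) := by
  rw [show r * n * D + i + 1 + j * D = (r * n * D + i + j * D) + 1 by ring]
  exact one_sub_one_div_nonneg

lemma denomRatio_le_one (D r σ n i : ℕ) : denomRatio D r σ n i ≤ 1 := by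
  refine Finset.prod_le_one (fun j _ => pow_nonneg (denomRatio_factor_nonneg _ _ _ _ _) _)
    fun j _ => pow_le_one₀ (denomRatio_factor_nonneg _ _ _ _ _) ?_
  rw [sub_le_self_iff]
  positivity

lemma monotone_denomRatio (D r σ n : ℕ) : Monotone (denomRatio D r σ n) := by
  intro a b hab
  refine Finset.prod_le_prod (fun j _ => pow_nonneg (denomRatio_factor_nonneg _ _ _ _ _) _)
    fun j _ => pow_le_pow_left₀ (denomRatio_factor_nonneg _ _ _ _ _) ?_ _
  gcongr

lemma exp_neg_le_denomRatio (hD : 2 ≤ D) (hr : 0 < r) (hn : 0 < n) (i : ℕ) :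
    Real.exp (-σ) ≤ denomRatio D r σ n i := by
  have h1 : ∀ j ∈ Finset.range (n + 1), Real.exp (-(1 / (n + 1 : ℝ))) ^ σ ≤
      (1 - 1 / ((r * n * D + i + 1 + j * D : ℕ) : ℝ)) ^ σ := by
    intro j _
    refine pow_le_pow_left₀ (Real.exp_nonneg _) ?_ _
    have h2 : (n + 2 : ℝ) ≤ ((r * n * D + i + 1 + j * D : ℕ) : ℝ) := by
      have : n + 2 ≤ r * n * D + i + 1 + j * D := by
        have h3 : 1 * n * 2 ≤ r * n * D := by gcongr; omega
        have := Nat.zero_le (j * D)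
        omega
      exact_mod_cast this
    have h4 : Real.exp (-(1 / (n + 1 : ℝ))) ≤ 1 - 1 / (n + 2 : ℝ) := by
      rw [Real.exp_neg, inv_le_comm₀ (Real.exp_pos _)]
      · have h5 : 1 - 1 / (n + 2 : ℝ) = (n + 1) / (n + 2) := by
          field_simp
          ring
        rw [h5, inv_div]
        refine le_trans (le_of_eq ?_) (Real.add_one_le_exp _)
        field_simp
        ring
      · rw [sub_pos, div_lt_one (by positivity)]
        linarith [(Nat.cast_nonneg n : (0 : ℝ) ≤ n)]
    refine h4.trans ?_
    gcongr
  refine le_trans (le_of_eq ?_) (Finset.prod_le_prod (fun _ _ => by positivity) h1)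
  rw [Finset.prod_const, Finset.card_range, ← pow_mul, ← Real.exp_nat_mul]
  congr 1
  push_cast
  field_simp

lemma sum_abs_term_sub_le (hD : 2 ≤ D) (hr : 0 < r) (hn : 0 < n) {A : ℝ}
    (hA : HasSum (fun q => (term D r σ n (q + 1) : ℝ)) A) (N : ℕ) :
    ∑ q ∈ Finset.range N, |(term D r σ n (q + 1) : ℝ) - term D r σ n q| ≤
      (1 + Real.exp σ) / 2 / √n * A := by
  set K := r * n * D with hK
  set M : ℕ := (2 * r + 1) * D * n + 1 with hM
  have hM0 : (0 : ℝ) < M := by positivity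
  have hnM : (n : ℝ) ≤ M := by
    have : 1 * 1 * n ≤ (2 * r + 1) * D * n := by gcongr <;> omega
    have : n ≤ M := by omega
    exact_mod_cast this
  have hn' : (0 : ℝ) < n := by positivity
  have hA' : HasSum (fun i => (term D r σ n (K + (i + 1)) : ℝ)) A := by
    have h1 := (hasSum_nat_add_iff' K).2 hA
    rw [Finset.sum_eq_zero, sub_zero] at h1
    · refine h1.congr_fun fun i => ?_
      rw [show i + K + 1 = K + (i + 1) by ring]
    · intro q hq
      rw [Finset.mem_range] at hq
      rw [term_eq_zero (by omega), Rat.cast_zero]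
  have key := sum_abs_sub_le (a := fun i => (term D r σ n (K + i) : ℝ))
    (u := fun i => (i : ℝ) / (i + M)) (v := denomRatio D r σ n) (c := Real.exp (-σ))
    (L := 1 / n) (lam := √n) (A := A) (fun i => cast_term_add_nonneg _ _ _ _ _)
    (by simp [term_eq_zero (le_refl K)]) hA'
    (fun i => term_recurrence (by omega) hr hn i) (Real.exp_pos _)
    (fun i => exp_neg_le_denomRatio hD hr hn i) (fun i => denomRatio_le_one _ _ _ _ _)
    (monotone_denomRatio _ _ _ _) (fun i => by positivity) (by positivity)
    (fun i => by
      have h1 : (((i + 1 : ℕ) : ℝ)) / ((i + 1 : ℕ) + M) - (i : ℝ) / (i + M) =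
          M / ((i + 1 + M) * (i + M)) := by
        push_cast
        field_simp
        ring
      rw [h1, div_le_div_iff₀ (by positivity) hn']
      have : (0 : ℝ) ≤ i := Nat.cast_nonneg i
      nlinarith [mul_nonneg this this, mul_nonneg this hM0.le]) (by positivity)
  have hB : (√n * (1 / n) + 1 / (√n * Real.exp (-σ))) / 2 * A =
      (1 + Real.exp σ) / 2 / √n * A := by
    have h1 : √(n : ℝ) ≠ 0 := by positivity
    have h2 : √(n : ℝ) * (1 / n) = 1 / √n := by
      rw [mul_one_div, div_eq_div_iff hn'.ne' h1, Real.mul_self_sqrt hn'.le, one_mul]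
    rw [h2, Real.exp_neg]
    have := Real.exp_ne_zero (σ : ℝ)
    field_simp
  rw [hB] at key
  have hle : ∑ q ∈ Finset.range N, |(term D r σ n (q + 1) : ℝ) - term D r σ n q| ≤
      ∑ q ∈ Finset.range (K + N), |(term D r σ n (q + 1) : ℝ) - term D r σ n q| :=
    Finset.sum_le_sum_of_subset_of_nonneg (Finset.range_mono (by omega))
      fun _ _ _ => abs_nonneg _
  refine hle.trans ?_
  rw [Finset.sum_range_add, Finset.sum_eq_zero, zero_add]
  · exact key N
  · intro q hq
    rw [Finset.mem_range] at hq
    rw [term_eq_zero (by omega), term_eq_zero (by omega)]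
    simp

lemma abs_mul_sum_sub_le (hD : 2 ≤ D) (hr : 0 < r) (hn : 0 < n) {h : ℕ} (hh : 0 < h) {A S : ℝ}
    (hA : HasSum (fun q => (term D r σ n (q + 1) : ℝ)) A)
    (hS : HasSum (fun p => (term D r σ n ((p + 1) * h) : ℝ)) S) :
    |h * S - A| ≤ h * ((1 + Real.exp σ) / 2 / √n * A) :=
  abs_mul_sub_le (a := fun q => (term D r σ n q : ℝ)) hh hA hS (sum_abs_term_sub_le hD hr hn hA)

end OddZeta

namespace OddZeta

open Filter Topology

variable {D r σ n : ℕ}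

lemma cast_term_le (hD : 0 < D) (hr : 0 < r) (hn : 0 < n) (hσ : 3 ≤ σ)
    (hQ : (2 * r + 1) * D ≤ σ) (q : ℕ) :
    (term D r σ n (q + 1) : ℝ) ≤ 3 * D ^ 2 * (1 / ((q : ℝ) + 1) ^ 2) *
      (((3 * D * r : ℕ) : ℝ) ^ ((2 * r + 1) * D) / (r : ℝ) ^ σ) ^ n := by
  rcases le_or_gt (q + 1) (r * n * D) with h | h
  · rw [term_eq_zero h, Rat.cast_zero]
    positivity
  obtain ⟨i, hi⟩ := Nat.exists_eq_add_of_lt h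
  have hq : q + 1 = r * n * D + (i + 1) := by omega
  have hqr : ((q : ℝ) + 1) = ((r * n * D + (i + 1) : ℕ) : ℝ) := by
    rw [← hq]; push_cast; ring
  rw [hq, cast_term_add, hqr, ← hq]
  clear hqr
  obtain ⟨s, rfl⟩ := Nat.exists_eq_add_of_le hQ
  set Q := (2 * r + 1) * D with hQdef
  have hD' : (0 : ℝ) < D := by positivity
  have hr' : (0 : ℝ) < r := by positivity
  set t : ℝ := ((q + 1 : ℕ) : ℝ) / D with ht
  have hqt : ((q + 1 : ℕ) : ℝ) = D * t := by rw [ht]; field_simp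
  have hrn : (r * n : ℝ) ≤ t := by
    rw [ht, le_div_iff₀ hD']
    exact_mod_cast (by omega : r * n * D ≤ q + 1)
  have hrn1 : (1 : ℝ) ≤ r * n := by exact_mod_cast Nat.mul_pos hr hn
  have ht1 : 1 ≤ t := hrn1.trans hrn
  have ht0 : 0 < t := by linarith
  have hnum : ∏ j ∈ Finset.range (Q * n + 1), (((i + 1 : ℕ) : ℝ) + j) ≤
      (3 * D * t) ^ (Q * n + 1) := by
    refine (Finset.prod_le_prod (g := fun _ => 3 * D * t) (fun j _ => by positivity)
      fun j hj => ?_).trans (by simp)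
    rw [Finset.mem_range] at hj
    have h1 : i + 1 + j ≤ 3 * (q + 1) := by
      have h2 : Q * n = 2 * (r * n * D) + n * D := by rw [hQdef]; ring
      have h3 : 1 * (n * D) ≤ r * (n * D) := by gcongr; omega
      have h4 : r * n * D = r * (n * D) := by ring
      omega
    rw [mul_assoc, ← hqt]
    exact_mod_cast h1
  have hden : (t ^ (Q + s)) ^ (n + 1) ≤ ∏ j ∈ Finset.range (n + 1), (t + j) ^ (Q + s) := by
    refine le_trans (le_of_eq (by simp)) (Finset.prod_le_prod (fun _ _ => by positivity)
      (fun j _ => pow_le_pow_left₀ ht0.le (show t ≤ t + j by simp) (Q + s)))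
  have hfac : (n ! : ℝ) ≤ (t / r) ^ n := by
    calc (n ! : ℝ) ≤ (n : ℝ) ^ n := by exact_mod_cast Nat.factorial_le_pow n
      _ ≤ (t / r) ^ n := by
        gcongr
        rw [le_div_iff₀ hr', mul_comm]
        exact hrn
  have hfac0 : (n ! : ℝ) ≠ 0 := by positivity
  have hpre : (n ! : ℝ) ^ (Q + s) / ((n ! : ℝ) ^ Q * D) = (n ! : ℝ) ^ s / D := by
    rw [pow_add]
    field_simp
  rw [hpre, hqt]
  calc (n ! : ℝ) ^ s / D * (∏ j ∈ Finset.range (Q * n + 1), (((i + 1 : ℕ) : ℝ) + j)) /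
        ∏ j ∈ Finset.range (n + 1), (t + j) ^ (Q + s)
      ≤ ((t / r) ^ n) ^ s / D * (3 * D * t) ^ (Q * n + 1) / (t ^ (Q + s)) ^ (n + 1) := by
        gcongr
    _ = 3 * D ^ 2 * (t / (D ^ 2 * t ^ (Q + s))) *
        (((3 * D * r : ℕ) : ℝ) ^ Q / (r : ℝ) ^ (Q + s)) ^ n := by
        push_cast
        simp only [div_pow, mul_pow, pow_succ, pow_add, pow_mul, pow_zero, one_mul]
        have e1 : (t ^ n) ^ s = (t ^ s) ^ n := by rw [← pow_mul, ← pow_mul, mul_comm]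
        have e2 : ((r : ℝ) ^ n) ^ s = (r ^ s) ^ n := by rw [← pow_mul, ← pow_mul, mul_comm]
        rw [e1, e2]
        field_simp
    _ ≤ 3 * D ^ 2 * (1 / (D * t) ^ 2) *
        (((3 * D * r : ℕ) : ℝ) ^ Q / (r : ℝ) ^ (Q + s)) ^ n := by
        have : t / (D ^ 2 * t ^ (Q + s)) ≤ 1 / (D * t) ^ 2 := by
          rw [div_le_div_iff₀ (by positivity) (by positivity), mul_pow, one_mul]
          have := pow_le_pow_right₀ ht1 hσ
          calc t * (D ^ 2 * t ^ 2) = D ^ 2 * t ^ 3 := by ring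
            _ ≤ D ^ 2 * t ^ (Q + s) := by gcongr
        gcongr

lemma lcmUpto_le_pow (n : ℕ) : (Nat.lcmUpto n : ℝ) ≤ 256 ^ n := by
  have h1 := Chebyshev.psi_le_const_mul_self (Nat.cast_nonneg n : (0 : ℝ) ≤ n)
  rw [Chebyshev.psi_eq_log_lcmUpto] at h1
  have h2 : Real.log 4 + 4 ≤ Real.log 256 := by
    rw [show (4 : ℝ) = 2 ^ 2 by norm_num, show (256 : ℝ) = 2 ^ 8 by norm_num, Real.log_pow,
      Real.log_pow]
    push_cast
    linarith [Real.log_two_gt_d9]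
  have h3 : Real.log (Nat.lcmUpto n) ≤ Real.log (256 ^ n) := by
    rw [Real.log_pow]
    refine h1.trans ?_
    rw [mul_comm]
    gcongr
  exact (Real.log_le_log_iff (by exact_mod_cast Nat.lcmUpto_pos n) (by positivity)).1 h3

/-- For `r = 512`, the sum of the terms times the common denominator decays geometrically. -/
lemma lcmUpto_pow_mul_le (hD : 0 < D) (hn : 0 < n) (hσ : 3 ≤ σ)
    (hQ : (2 * 512 + 1) * D ≤ σ) {A : ℝ}
    (hA : HasSum (fun q => (term D 512 σ n (q + 1) : ℝ)) A) :
    (Nat.lcmUpto n : ℝ) ^ σ * A ≤ 3 * D ^ 2 * zetaVal 2 *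
      (((1536 * D : ℕ) : ℝ) ^ (1025 * D) / 2 ^ σ) ^ n := by
  have hs : HasSum (fun q : ℕ => 1 / ((q : ℝ) + 1) ^ 2) (zetaVal 2) := by
    have := hasSum_zetaTerm (e := 1) (i := 2) le_rfl
    rw [Nat.cast_one, one_pow, one_mul] at this
    exact this.congr_fun fun q => by rw [zetaTerm, Nat.cast_one, div_one]
  have h1 := hasSum_le (fun q => cast_term_le hD (by norm_num) hn hσ hQ q) hA
    ((hs.mul_left (3 * (D : ℝ) ^ 2)).mul_right _)
  have hz : 0 ≤ zetaVal 2 := tsum_nonneg fun _ => by positivity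
  calc (Nat.lcmUpto n : ℝ) ^ σ * A ≤ (256 ^ n) ^ σ * (3 * D ^ 2 * zetaVal 2 *
      (((3 * D * 512 : ℕ) : ℝ) ^ ((2 * 512 + 1) * D) / ((512 : ℕ) : ℝ) ^ σ) ^ n) := by
        refine mul_le_mul (pow_le_pow_left₀ (by positivity) (lcmUpto_le_pow n) _) h1
          (hA.nonneg fun q => cast_term_nonneg _ _ _ _ _) (by positivity)
    _ = _ := by
        have e1 : ((256 : ℝ) ^ n) ^ σ = (256 ^ σ) ^ n := by rw [← pow_mul, ← pow_mul, mul_comm]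
        have e2 : ((512 : ℕ) : ℝ) ^ σ = 256 ^ σ * 2 ^ σ := by rw [← mul_pow]; norm_num
        have e3 : 3 * D * 512 = 1536 * D := by ring
        rw [e1, e2, e3, show 2 * 512 + 1 = 1025 by norm_num, mul_left_comm, ← mul_pow]
        congr 2
        field_simp

end OddZeta

namespace OddZeta

section Descartes

open Polynomial

lemma signVariations_add_one_le_card_support {P : ℚ[X]} (hP : P ≠ 0) :
    P.signVariations + 1 ≤ P.support.card := by
  induction hk : P.support.card using Nat.strong_induction_on generalizing P with
  | _ k ih =>
    by_cases h0 : P.eraseLead = 0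
    · have hmono : P = monomial P.natDegree P.leadingCoeff := by
        conv_lhs => rw [← P.eraseLead_add_monomial_natDegree_leadingCoeff, h0, zero_add]
      have h1 : P.signVariations = 0 := by
        rw [hmono]
        exact signVariations_monomial _ _
      have h2 : 0 < P.support.card := Finset.card_pos.2 (support_nonempty.2 hP)
      omega
    · have h1 := eraseLead_support_card_lt hP
      have h2 := ih _ (hk ▸ h1) h0 rfl
      have h3 := signVariations_le_eraseLead_succ P
      omega

/-- A nonzero polynomial has fewer positive roots than it has terms. -/
lemma card_lt_card_support {P : ℚ[X]} (hP : P ≠ 0) {S : Finset ℚ} (hpos : ∀ x ∈ S, 0 < x)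
    (hroot : ∀ x ∈ S, P.IsRoot x) : S.card < P.support.card := by
  refine lt_of_lt_of_le ?_ (signVariations_add_one_le_card_support hP)
  refine Nat.lt_succ_of_le (le_trans ?_ P.roots_countP_pos_le_signVariations)
  rw [Multiset.countP_eq_card_filter]
  refine Multiset.card_le_card ((Multiset.le_iff_subset S.nodup).2 fun x hx => ?_)
  rw [Multiset.mem_filter]
  exact ⟨(mem_roots hP).2 (hroot x hx), hpos x hx⟩

end Descartes

/-- Given more positive integers `e` than exponents `i ≠ 1`, some weights annihilate all these
power sums, but not the sum of first powers. -/
lemma exists_weights {S I : Finset ℕ} (hS : ∀ e ∈ S, 0 < e) (hI : 1 ∉ I) (hcard : I.card < S.card) :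
    ∃ w : ℕ → ℚ, (∀ i ∈ I, ∑ e ∈ S, w e * (e : ℚ) ^ i = 0) ∧ ∑ e ∈ S, w e * (e : ℚ) ≠ 0 := by
  classical
  by_contra! hcon
  have hker : ⨅ i : I, LinearMap.ker
      (Fintype.linearCombination ℚ (fun e : S => ((e : ℕ) : ℚ) ^ (i : ℕ))) ≤
      LinearMap.ker (Fintype.linearCombination ℚ (fun e : S => ((e : ℕ) : ℚ))) := by
    intro w hw
    simp only [Submodule.mem_iInf, LinearMap.mem_ker, Fintype.linearCombination_apply,
      smul_eq_mul] at hw ⊢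
    have hext : ∀ f : ℕ → ℚ, ∑ e ∈ S, (if h : e ∈ S then w ⟨e, h⟩ else 0) * f e =
        ∑ e : S, w e * f e := by
      intro f
      rw [← Finset.sum_coe_sort]
      exact Finset.sum_congr rfl fun e _ => by simp
    have := hcon (fun e => if h : e ∈ S then w ⟨e, h⟩ else 0) fun i hi => by
      rw [hext fun e => (e : ℚ) ^ i]
      exact hw ⟨i, hi⟩
    rw [hext fun e => (e : ℚ)] at this
    exact this
  obtain ⟨c, hc⟩ := (Submodule.mem_span_range_iff_exists_fun ℚ).1 (mem_span_of_iInf_ker_le_ker hker)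
  let P : Polynomial ℚ := Polynomial.X - ∑ i : I, Polynomial.monomial (i : ℕ) (c i)
  have hPc : P.coeff 1 = 1 := by
    simp only [P, Polynomial.coeff_sub, Polynomial.coeff_X_one, Polynomial.finsetSum_coeff,
      Polynomial.coeff_monomial]
    rw [Finset.sum_eq_zero, sub_zero]
    intro i _
    rw [if_neg]
    rintro h
    exact hI (h ▸ i.2)
  have hP0 : P ≠ 0 := by
    intro h
    rw [h] at hPc
    simp at hPc
  have hsupp : P.support ⊆ insert 1 I := by
    intro j hj
    by_contra hj'
    rw [Finset.mem_insert, not_or] at hj'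
    refine Polynomial.mem_support_iff.1 hj ?_
    simp only [P, Polynomial.coeff_sub, Polynomial.coeff_X, Polynomial.finsetSum_coeff,
      Polynomial.coeff_monomial]
    rw [if_neg (Ne.symm hj'.1), Finset.sum_eq_zero, sub_zero]
    intro i _
    rw [if_neg]
    rintro h
    exact hj'.2 (h ▸ i.2)
  have hlt := card_lt_card_support hP0 (S := S.image (fun e : ℕ => (e : ℚ)))
    (by
      simp only [Finset.mem_image, forall_exists_index, and_imp, forall_apply_eq_imp_iff₂]
      exact fun e he => by exact_mod_cast hS e he)
    (by
      simp only [Finset.mem_image, forall_exists_index, and_imp, forall_apply_eq_imp_iff₂]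
      intro e he
      have := LinearMap.congr_fun hc (Pi.single ⟨e, he⟩ 1)
      simp only [LinearMap.coe_sum, LinearMap.coe_smul, Finset.sum_apply, Pi.smul_apply,
        Fintype.linearCombination_apply_single, one_mul, smul_eq_mul] at this
      simp only [P, Polynomial.IsRoot, Polynomial.eval_sub, Polynomial.eval_X,
        Polynomial.eval_finsetSum, Polynomial.eval_monomial]
      rw [this, sub_self])
  rw [Finset.card_image_of_injective _ Nat.cast_injective] at hlt
  have h1 := (Finset.card_le_card hsupp).trans (Finset.card_insert_le _ _)
  omega

end OddZeta

namespace OddZeta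

open Filter Topology

variable {D r σ n : ℕ}

/-- The linear form in odd zeta values attached to the divisor `e` of `D`. -/
noncomputable def formVal (D r σ n e : ℕ) : ℝ :=
  ∑ i ∈ (Finset.Icc 3 (σ - 1)).filter Odd,
    (zetaCoeff D r σ n i : ℝ) * (e : ℝ) ^ i * zetaVal i - constCoeff D r σ n e

lemma exists_int_weighted_formVal (hD : 0 < D) (hσ : 0 < σ) {d : ℕ}
    (hd : ∀ l, 1 ≤ l → l ≤ n → l ∣ d) {w z : ℕ → ℚ} {b : ℤ}
    (hw : ∀ e ∈ D.divisors, ∃ y : ℤ, b * w e = y)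
    (hz : ∀ i ∈ (Finset.Icc 3 (σ - 1)).filter Odd, ∃ y : ℤ, b * z i = y)
    (hwz : ∀ i ∈ (Finset.Icc 3 (σ - 1)).filter Odd,
      ∑ e ∈ D.divisors, w e * (e : ℚ) ^ i = 0 ∨ zetaVal i = z i) :
    ∃ y : ℤ, (d : ℝ) ^ σ * b ^ 2 * ∑ e ∈ D.divisors, (w e : ℝ) * formVal D r σ n e = y := by
  set J := (Finset.Icc 3 (σ - 1)).filter Odd with hJ
  have h1 : ∑ e ∈ D.divisors, (w e : ℝ) * formVal D r σ n e =
      ((∑ e ∈ D.divisors, w e * (∑ i ∈ J, zetaCoeff D r σ n i * (e : ℚ) ^ i * z i -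
        constCoeff D r σ n e) : ℚ) : ℝ) := by
    rw [← sub_eq_zero]
    push_cast
    rw [← Finset.sum_sub_distrib]
    have h2 : ∀ e ∈ D.divisors, (w e : ℝ) * formVal D r σ n e -
        w e * (∑ i ∈ J, (zetaCoeff D r σ n i : ℝ) * (e : ℝ) ^ i * z i - constCoeff D r σ n e) =
        ∑ i ∈ J, (zetaCoeff D r σ n i : ℝ) * (zetaVal i - z i) * (w e * (e : ℝ) ^ i) := by
      intro e _
      rw [formVal, ← mul_sub, sub_sub_sub_cancel_right, ← Finset.sum_sub_distrib, Finset.mul_sum]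
      exact Finset.sum_congr rfl fun i _ => by ring
    rw [Finset.sum_congr rfl h2, Finset.sum_comm]
    refine Finset.sum_eq_zero fun i hi => ?_
    rw [← Finset.mul_sum]
    rcases hwz i hi with h | h
    · have h3 : ∑ e ∈ D.divisors, (w e : ℝ) * (e : ℝ) ^ i = 0 := by exact_mod_cast h
      rw [h3, mul_zero]
    · rw [h, sub_self, mul_zero, zero_mul]
  have hrange : ∀ {x : ℚ}, (∃ y : ℤ, x = y) → x ∈ (Int.castRingHom ℚ).range := by
    rintro x ⟨y, rfl⟩
    exact ⟨y, rfl⟩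
  have h2 : (d : ℚ) ^ σ * b ^ 2 * ∑ e ∈ D.divisors,
      w e * (∑ i ∈ J, zetaCoeff D r σ n i * (e : ℚ) ^ i * z i - constCoeff D r σ n e) ∈
        (Int.castRingHom ℚ).range := by
    have h3 : (d : ℚ) ^ σ * b ^ 2 * ∑ e ∈ D.divisors,
        w e * (∑ i ∈ J, zetaCoeff D r σ n i * (e : ℚ) ^ i * z i - constCoeff D r σ n e) =
        ∑ e ∈ D.divisors, (b * w e) * (∑ i ∈ J, (d ^ σ * zetaCoeff D r σ n i) * (e : ℚ) ^ i *
          (b * z i) - b * (d ^ σ * constCoeff D r σ n e)) := by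
      rw [Finset.mul_sum]
      refine Finset.sum_congr rfl fun e _ => ?_
      have h4 : ∑ i ∈ J, (d ^ σ * zetaCoeff D r σ n i) * (e : ℚ) ^ i * (b * z i) =
          d ^ σ * b * ∑ i ∈ J, zetaCoeff D r σ n i * (e : ℚ) ^ i * z i := by
        rw [Finset.mul_sum]
        exact Finset.sum_congr rfl fun i _ => by ring
      rw [h4]
      ring
    rw [h3]
    refine sum_mem fun e he => mul_mem (hrange (hw e he)) (sub_mem (sum_mem fun i hi => ?_) ?_)
    · exact mul_mem (mul_mem (hrange (exists_int_zetaCoeff hD hd i))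
        (pow_mem (natCast_mem _ _) _)) (hrange (hz i hi))
    · exact mul_mem (intCast_mem _ _)
        (hrange (exists_int_constCoeff hD hσ hd (Nat.dvd_of_mem_divisors he)))
  obtain ⟨y, hy⟩ := h2
  refine ⟨y, ?_⟩
  rw [h1]
  have := congrArg (fun x : ℚ => (x : ℝ)) hy
  simp only [eq_intCast] at this
  rw [Rat.cast_intCast] at this
  rw [this]
  push_cast
  rfl

lemma hasSum_term_divisor (hD : Even D) (hD0 : 0 < D) (hσ : Even σ) (hσ0 : 0 < σ)
    (hdeg : (2 * r + 1) * D * n + 2 < (n + 1) * σ) {e : ℕ} (he : e ∈ D.divisors) :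
    HasSum (fun p : ℕ => (term D r σ n ((p + 1) * (D / e)) : ℝ)) (formVal D r σ n e) :=
  hasSum_term hD hD0 hσ hσ0 hdeg (Nat.mul_div_cancel' (Nat.dvd_of_mem_divisors he))

lemma hasSum_term_self (hD : Even D) (hD0 : 0 < D) (hσ : Even σ) (hσ0 : 0 < σ)
    (hdeg : (2 * r + 1) * D * n + 2 < (n + 1) * σ) :
    HasSum (fun q : ℕ => (term D r σ n (q + 1) : ℝ)) (formVal D r σ n D) := by
  have := hasSum_term_divisor hD hD0 hσ hσ0 hdeg (Nat.mem_divisors_self D hD0.ne')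
  simpa only [Nat.div_self hD0, mul_one] using this

lemma formVal_self_pos (hD : Even D) (hD0 : 0 < D) (hσ : Even σ) (hσ0 : 0 < σ)
    (hdeg : (2 * r + 1) * D * n + 2 < (n + 1) * σ) : 0 < formVal D r σ n D := by
  have h := hasSum_term_self hD hD0 hσ hσ0 hdeg
  refine lt_of_lt_of_le ?_ (le_hasSum h (r * n * D) fun q _ => cast_term_nonneg _ _ _ _ _)
  exact cast_term_add_succ_pos hD0 r σ n 0

lemma abs_weighted_formVal_sub_le (hD : Even D) (hD0 : 0 < D) (hσ : Even σ) (hσ0 : 0 < σ)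
    (hdeg : (2 * r + 1) * D * n + 2 < (n + 1) * σ) (hr : 0 < r) (hn : 0 < n) (w : ℕ → ℚ) :
    |D * ∑ e ∈ D.divisors, (w e : ℝ) * formVal D r σ n e -
      (∑ e ∈ D.divisors, (w e : ℝ) * e) * formVal D r σ n D| ≤
      (D * ∑ e ∈ D.divisors, |(w e : ℝ)|) *
        ((1 + Real.exp σ) / 2 / √n * formVal D r σ n D) := by
  have hD2 : 2 ≤ D := by
    obtain ⟨a, ha⟩ := hD
    omega
  rw [Finset.mul_sum, Finset.sum_mul, ← Finset.sum_sub_distrib, Finset.mul_sum, Finset.sum_mul]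
  refine (Finset.abs_sum_le_sum_abs _ _).trans (Finset.sum_le_sum fun e he => ?_)
  have hmul : (e : ℝ) * ((D / e : ℕ) : ℝ) = D := by
    exact_mod_cast Nat.mul_div_cancel' (Nat.dvd_of_mem_divisors he)
  have h1 := abs_mul_sum_sub_le hD2 hr hn
    (Nat.div_pos (Nat.divisor_le he) (Nat.pos_of_mem_divisors he))
    (hasSum_term_self hD hD0 hσ hσ0 hdeg) (hasSum_term_divisor hD hD0 hσ hσ0 hdeg he)
  have h2 : D * ((w e : ℝ) * formVal D r σ n e) - w e * e * formVal D r σ n D =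
      w e * e * (((D / e : ℕ) : ℝ) * formVal D r σ n e - formVal D r σ n D) := by
    rw [← hmul]
    ring
  rw [h2, abs_mul, abs_mul, Nat.abs_cast]
  calc |(w e : ℝ)| * e * |((D / e : ℕ) : ℝ) * formVal D r σ n e - formVal D r σ n D|
      ≤ |(w e : ℝ)| * e *
        (((D / e : ℕ) : ℝ) * ((1 + Real.exp σ) / 2 / √n * formVal D r σ n D)) := by gcongr
    _ = (D : ℝ) * |(w e : ℝ)| * ((1 + Real.exp σ) / 2 / √n * formVal D r σ n D) := by
      rw [← hmul]
      ring

open Classical in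
/-- The number of irrational odd zeta values up to `σ - 1` is at least the number of divisors
of `D`. -/
theorem card_divisors_le_card_irrational (hD : Even D) (hD0 : 0 < D) (hσ : Even σ)
    (hcond : (1536 * D) ^ (1025 * D) < 2 ^ σ) :
    D.divisors.card ≤ ((Finset.Icc 3 (σ - 1)).filter
      fun i => Odd i ∧ Irrational (zetaVal i)).card := by
  have hQ : (2 * 512 + 1) * D < σ := by
    have h1 : 2 ^ (1025 * D) < 2 ^ σ :=
      (Nat.pow_le_pow_left (by omega : 2 ≤ 1536 * D) _).trans_lt hcond
    exact (Nat.pow_lt_pow_iff_right (by norm_num)).1 h1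
  have hdeg : ∀ n, (2 * 512 + 1) * D * n + 2 < (n + 1) * σ := by
    intro n
    have : (2 * 512 + 1) * D * n ≤ n * σ := by
      rw [mul_comm]
      exact Nat.mul_le_mul_left _ hQ.le
    rw [add_mul n 1 σ, one_mul]
    omega
  have hσ0 : 0 < σ := by omega
  by_contra! hlt
  set I := (Finset.Icc 3 (σ - 1)).filter fun i => Odd i ∧ Irrational (zetaVal i) with hI
  set J := (Finset.Icc 3 (σ - 1)).filter Odd with hJ
  obtain ⟨w, hw0, hw1⟩ := exists_weights (S := D.divisors) (I := I)
    (fun e he => Nat.pos_of_mem_divisors he) (by simp [hI]) hlt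
  have hrat : ∀ i, ∃ x : ℚ, i ∈ J → i ∉ I → zetaVal i = x := by
    intro i
    by_cases h : i ∈ J ∧ i ∉ I
    · have h1 : ¬ Irrational (zetaVal i) := by
        intro h2
        obtain ⟨h3, h4⟩ := Finset.mem_filter.1 h.1
        exact h.2 (Finset.mem_filter.2 ⟨h3, h4, h2⟩)
      obtain ⟨x, hx⟩ := not_not.1 h1
      exact ⟨x, fun _ _ => hx.symm⟩
    · exact ⟨0, fun h1 h2 => absurd ⟨h1, h2⟩ h⟩
  choose z hz using hrat
  obtain ⟨⟨b, hb0⟩, hb⟩ := IsLocalization.exist_integer_multiples_of_finset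
    (nonZeroDivisors ℤ) (D.divisors.image w ∪ J.image z)
  have hb' : ∀ x ∈ D.divisors.image w ∪ J.image z, ∃ y : ℤ, (b : ℚ) * x = y := by
    intro x hx
    obtain ⟨y, hy⟩ := hb x hx
    refine ⟨y, ?_⟩
    simp only [algebraMap_int_eq, eq_intCast, zsmul_eq_mul] at hy
    exact hy.symm
  have hbne : b ≠ 0 := nonZeroDivisors.ne_zero hb0
  set W1 : ℝ := ∑ e ∈ D.divisors, (w e : ℝ) * e with hW1
  set W : ℝ := D * ∑ e ∈ D.divisors, |(w e : ℝ)| with hW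
  have hW1ne : W1 ≠ 0 := by
    rw [hW1]
    exact_mod_cast hw1
  have hW1pos : 0 < |W1| := abs_pos.2 hW1ne
  have hD' : (0 : ℝ) < D := by positivity
  set ρ : ℝ := ((1536 * D : ℕ) : ℝ) ^ (1025 * D) / 2 ^ σ with hρ
  have hρ1 : ρ < 1 := by
    rw [hρ, div_lt_one (by positivity)]
    exact_mod_cast hcond
  have hlim1 : Tendsto (fun n : ℕ => W * ((1 + Real.exp σ) / 2 / √n)) atTop (𝓝 (W * 0)) :=
    (tendsto_const_nhds.div_atTop
      (Real.tendsto_sqrt_atTop.comp tendsto_natCast_atTop_atTop)).const_mul _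
  have hlim2 : Tendsto (fun n : ℕ => (b : ℝ) ^ 2 * (2 * |W1|) * (3 * D ^ 2 * zetaVal 2 * ρ ^ n))
      atTop (𝓝 ((b : ℝ) ^ 2 * (2 * |W1|) * (3 * D ^ 2 * zetaVal 2 * 0))) :=
    ((tendsto_pow_atTop_nhds_zero_of_lt_one (by positivity) hρ1).const_mul _).const_mul _
  have hbd1 : W * 0 < |W1| := by rwa [mul_zero]
  have hbd2 : (b : ℝ) ^ 2 * (2 * |W1|) * (3 * D ^ 2 * zetaVal 2 * 0) < D := by
    rwa [mul_zero, mul_zero]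
  obtain ⟨n, hn1, hn2, hn⟩ := ((hlim1.eventually_lt_const hbd1).and
    ((hlim2.eventually_lt_const hbd2).and (eventually_gt_atTop 0))).exists
  set A := formVal D 512 σ n D with hA
  set S := ∑ e ∈ D.divisors, (w e : ℝ) * formVal D 512 σ n e with hS
  have hApos : 0 < A := formVal_self_pos hD hD0 hσ hσ0 (hdeg n)
  have happ : |D * S - W1 * A| ≤ W * ((1 + Real.exp σ) / 2 / √n * A) :=
    abs_weighted_formVal_sub_le hD hD0 hσ hσ0 (hdeg n) (by norm_num) hn w
  have happ' : |D * S - W1 * A| < |W1| * A := by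
    refine happ.trans_lt ?_
    rw [← mul_assoc]
    exact mul_lt_mul_of_pos_right hn1 hApos
  have hSne : S ≠ 0 := by
    intro h
    rw [h, mul_zero, zero_sub, abs_neg, abs_mul, abs_of_pos hApos] at happ'
    exact lt_irrefl _ happ'
  have hSle : D * |S| ≤ 2 * |W1| * A := by
    have h1 : |D * S| ≤ |D * S - W1 * A| + |W1 * A| := by
      have := abs_add_le (D * S - W1 * A) (W1 * A)
      rwa [sub_add_cancel] at this
    rw [abs_mul, abs_mul, Nat.abs_cast, abs_of_pos hApos] at h1
    linarith
  have hsize := lcmUpto_pow_mul_le hD0 hn (by omega) hQ.le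
    (hasSum_term_self hD hD0 hσ hσ0 (hdeg n))
  rw [← hA, ← hρ] at hsize
  obtain ⟨y, hy⟩ := exists_int_weighted_formVal (r := 512) (n := n) (d := Nat.lcmUpto n)
    (w := w) (z := z) (b := b) hD0 hσ0
    (fun l h1 h2 => Finset.dvd_lcm (f := id) (Finset.mem_Icc.2 ⟨h1, h2⟩))
    (fun e he => hb' _ (Finset.mem_union_left _ (Finset.mem_image_of_mem w he)))
    (fun i hi => hb' _ (Finset.mem_union_right _ (Finset.mem_image_of_mem z hi)))
    (fun i hi => by
      by_cases h : i ∈ I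
      · exact Or.inl (hw0 i h)
      · exact Or.inr (hz i hi h))
  rw [← hS] at hy
  have hdpos : (0 : ℝ) < (Nat.lcmUpto n : ℝ) ^ σ := by
    have := Nat.lcmUpto_pos n
    positivity
  have hb2 : (0 : ℝ) < (b : ℝ) ^ 2 := by positivity
  have hyne : y ≠ 0 := by
    intro h
    rw [h, Int.cast_zero] at hy
    exact mul_ne_zero (mul_ne_zero hdpos.ne' hb2.ne') hSne hy
  have hy1 : (1 : ℝ) ≤ |(y : ℝ)| := by exact_mod_cast Int.one_le_abs hyne
  rw [← hy, abs_mul, abs_mul, abs_of_pos hdpos, abs_of_pos hb2] at hy1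
  have h1 : (D : ℝ) ≤ (b : ℝ) ^ 2 * (2 * |W1|) * (3 * D ^ 2 * zetaVal 2 * ρ ^ n) := by
    calc (D : ℝ) = D * 1 := (mul_one _).symm
      _ ≤ D * ((Nat.lcmUpto n : ℝ) ^ σ * (b : ℝ) ^ 2 * |S|) := by gcongr
      _ = (Nat.lcmUpto n : ℝ) ^ σ * (b : ℝ) ^ 2 * (D * |S|) := by ring
      _ ≤ (Nat.lcmUpto n : ℝ) ^ σ * (b : ℝ) ^ 2 * (2 * |W1| * A) := by gcongr
      _ = (b : ℝ) ^ 2 * (2 * |W1|) * ((Nat.lcmUpto n : ℝ) ^ σ * A) := by ring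
      _ ≤ _ := by gcongr
  linarith

end OddZeta

namespace OddZeta
open Filter Topology

lemma two_pow_primeCounting_le_card_divisors (n : ℕ) :
    2 ^ Nat.primeCounting n ≤ (primorial n).divisors.card := by
  have hcard : Nat.primeCounting n = (primorial n).primeFactors.card := by
    rw [primeFactors_primorial, Nat.primesLE_card_eq_primeCounting]
  rw [Nat.card_divisors (primorial_ne_zero n), hcard]
  refine Finset.pow_card_le_prod _ _ _ fun p hp => ?_
  have := (Nat.prime_of_mem_primeFactors hp).factorization_pos_of_dvd (primorial_ne_zero n)
    (Nat.dvd_of_mem_primeFactors hp)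
  omega

lemma eventually_half_le_log_primorial :
    ∀ᶠ n : ℕ in atTop, (n : ℝ) / 2 ≤ Real.log (primorial n) := by
  have hlog := (isLittleO_log_rpow_atTop (r := 1 / 2) (by norm_num)).bound
    (c := 0.06) (by norm_num)
  filter_upwards [tendsto_natCast_atTop_atTop.eventually hlog, eventually_ge_atTop 4] with n hn hn4
  have hn4' : (4 : ℝ) ≤ n := by exact_mod_cast hn4
  have hln : 0 ≤ Real.log n := Real.log_nonneg (by linarith)
  rw [← Real.sqrt_eq_rpow, Real.norm_of_nonneg hln, Real.norm_of_nonneg (Real.sqrt_nonneg _)] at hn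
  have hθ := Chebyshev.theta_ge n
  rw [Chebyshev.theta_eq_log_primorial, Nat.floor_natCast] at hθ
  have hsq : √(n : ℝ) * √(n : ℝ) = n := Real.mul_self_sqrt (by linarith)
  have h2 : 2 ≤ √(n : ℝ) := Real.le_sqrt_of_sq_le (by linarith)
  have hlog1 : Real.log (n + 1) ≤ 2 * Real.log n := by
    rw [← Nat.cast_two, ← Real.log_pow]
    exact Real.log_le_log (by linarith) (by nlinarith)
  have hl2 := Real.log_two_gt_d9
  nlinarith [mul_le_mul_of_nonneg_right h2 hln,
    mul_le_mul_of_nonneg_left hn (Real.sqrt_nonneg (n : ℝ))]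

lemma eventually_exists_primorial {c : ℝ} (hc : 0 < c) (hc1 : c ≤ 1) :
    ∀ᶠ L : ℝ in atTop, ∃ N : ℕ, 2 ≤ N ∧ Real.log (primorial N) ≤ c * L ∧
      c * L ≤ (Nat.primeCounting N + 1) * (Real.log 3 + Real.log L) := by
  obtain ⟨n₀, hn₀⟩ := eventually_atTop.1 eventually_half_le_log_primorial
  have hcL : Tendsto (fun L : ℝ => c * L) atTop atTop := tendsto_id.const_mul_atTop hc
  filter_upwards [hcL.eventually_ge_atTop (Real.log 2), eventually_ge_atTop ((n₀ : ℝ) + 1)]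
    with L hL hLn
  have hn₀' : (0 : ℝ) ≤ n₀ := Nat.cast_nonneg _
  have hex : ∃ n : ℕ, c * L < Real.log (primorial n) := by
    obtain ⟨m, hm⟩ := exists_nat_gt (2 * (c * L))
    refine ⟨max m n₀, ?_⟩
    have h1 := hn₀ (max m n₀) (le_max_right _ _)
    have h2 : (m : ℝ) ≤ (max m n₀ : ℕ) := by exact_mod_cast le_max_left m n₀
    linarith
  classical
  set M := Nat.find hex with hM
  have hMspec : c * L < Real.log (primorial M) := Nat.find_spec hex
  have hM3 : 3 ≤ M := by
    by_contra! h
    have h1 : primorial M ≤ primorial 2 := primorial_mono (by omega)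
    rw [primorial_two] at h1
    have h2 : Real.log (primorial M) ≤ Real.log 2 :=
      Real.log_le_log (by exact_mod_cast primorial_pos M) (by exact_mod_cast h1)
    linarith
  obtain ⟨N, hN⟩ : ∃ N, M = N + 1 := ⟨M - 1, by omega⟩
  have hNle : Real.log (primorial N) ≤ c * L :=
    not_lt.1 (Nat.find_min hex (by omega : N < M))
  refine ⟨N, by omega, hNle, ?_⟩
  have hM3L : (M : ℝ) ≤ 3 * L := by
    rcases le_or_gt n₀ N with h | h
    · have h1 := hn₀ N h
      have h2 : c * L ≤ L := mul_le_of_le_one_left (by linarith) hc1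
      rw [hN, Nat.cast_add_one]
      linarith
    · have h1 : (M : ℝ) ≤ n₀ := by exact_mod_cast (by omega : M ≤ n₀)
      linarith
  have hM0 : (0 : ℝ) < M := by exact_mod_cast (by omega : 0 < M)
  have hlogM : Real.log M ≤ Real.log 3 + Real.log L := by
    rw [← Real.log_mul (by norm_num) (by linarith)]
    exact Real.log_le_log hM0 hM3L
  have hlogM0 : 0 ≤ Real.log M := Real.log_natCast_nonneg M
  have hπ : (Nat.primeCounting M : ℝ) ≤ Nat.primeCounting N + 1 := by
    have : Nat.primeCounting M ≤ Nat.primeCounting N + 1 := by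
      rw [hN, Nat.primeCounting, Nat.primeCounting, Nat.primeCounting', Nat.count_succ]
      split_ifs <;> omega
    exact_mod_cast this
  have hθ := Chebyshev.theta_le_pi_mul_log M
  rw [Chebyshev.theta_eq_log_primorial, Nat.floor_natCast] at hθ
  calc c * L ≤ Nat.primeCounting M * Real.log M := hMspec.le.trans hθ
    _ ≤ _ := by gcongr

lemma eventually_le_of_mul_le {c c' : ℝ} (h : c' < c) :
    ∀ᶠ L : ℝ in atTop, ∀ x : ℝ, c * L ≤ (x + 1) * (Real.log 3 + Real.log L) →
      c' * L / Real.log L ≤ x := by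
  have h1 : Tendsto (fun L : ℝ => c' * Real.log 3 / Real.log L +
      (Real.log 3 + Real.log L) / L) atTop (𝓝 (0 + 0)) := by
    refine (tendsto_const_nhds.div_atTop Real.tendsto_log_atTop).add ?_
    have h2 : Tendsto (fun L : ℝ => Real.log L / L) atTop (𝓝 0) := by
      simpa using Real.isLittleO_log_id_atTop.tendsto_div_nhds_zero
    have h3 : Tendsto (fun L : ℝ => Real.log 3 / L) atTop (𝓝 0) :=
      tendsto_const_nhds.div_atTop tendsto_id
    simpa only [add_div, add_zero] using h3.add h2
  filter_upwards [h1.eventually_lt_const (by simpa using sub_pos.2 h : 0 + 0 < c - c'),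
    eventually_gt_atTop 0, Real.tendsto_log_atTop.eventually_gt_atTop 0] with L hL hL0 hlog x hx
  have hl3 : 0 < Real.log 3 := Real.log_pos (by norm_num)
  refine le_of_mul_le_mul_right ?_ (add_pos hl3 hlog)
  have h4 : (c' * Real.log 3 / Real.log L + (Real.log 3 + Real.log L) / L) * L ≤ (c - c') * L :=
    mul_le_mul_of_nonneg_right hL.le hL0.le
  have h5 : (c' * Real.log 3 / Real.log L + (Real.log 3 + Real.log L) / L) * L =
      c' * L / Real.log L * (Real.log 3 + Real.log L) - c' * L +
        (Real.log 3 + Real.log L) := by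
    field_simp
    ring
  linarith

lemma eventually_linear_mul_exp_lt {c : ℝ} (hc : c < 1) :
    ∀ᶠ L : ℝ in atTop,
      1025 * Real.exp (c * L) * (Real.log 1536 + c * L) < Real.exp L * Real.log 2 := by
  have h1 : Tendsto (fun L : ℝ => 1025 * (Real.log 1536 * Real.exp (-(1 - c) * L) +
      c * (L ^ (1 : ℝ) * Real.exp (-(1 - c) * L)))) atTop
      (𝓝 (1025 * (Real.log 1536 * 0 + c * 0))) := by
    have hd : 0 < 1 - c := by linarith
    have h2 := tendsto_rpow_mul_exp_neg_mul_atTop_nhds_zero 1 (1 - c) hd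
    have h3 := tendsto_rpow_mul_exp_neg_mul_atTop_nhds_zero 0 (1 - c) hd
    simp only [Real.rpow_zero, one_mul] at h3
    exact ((h3.const_mul _).add (h2.const_mul _)).const_mul _
  have h0 : 1025 * (Real.log 1536 * 0 + c * 0) < Real.log 2 := by
    simpa using Real.log_pos (by norm_num : (1 : ℝ) < 2)
  filter_upwards [h1.eventually_lt_const h0] with L hL
  rw [Real.rpow_one] at hL
  have h4 : Real.exp (c * L) = Real.exp L * Real.exp (-(1 - c) * L) := by
    rw [← Real.exp_add]
    congr 1
    ring
  have := mul_lt_mul_of_pos_left hL (Real.exp_pos L)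
  rw [h4]
  linarith

lemma pow_lt_two_pow_of_log_le {D s : ℕ} {c : ℝ} (hD : 0 < D) (hs : 0 < s)
    (hDs : Real.log D ≤ c * Real.log s)
    (h : 1025 * Real.exp (c * Real.log s) * (Real.log 1536 + c * Real.log s) <
      Real.exp (Real.log s) * Real.log 2) :
    (1536 * D) ^ (1025 * D) < 2 ^ (s + 1) := by
  have hD' : (0 : ℝ) < D := by exact_mod_cast hD
  have hs' : (0 : ℝ) < s := by exact_mod_cast hs
  have hDexp : (D : ℝ) ≤ Real.exp (c * Real.log s) := (Real.log_le_iff_le_exp hD').1 hDs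
  rw [Real.exp_log hs'] at h
  have hlogD : 0 ≤ Real.log D := Real.log_natCast_nonneg D
  have hl : 0 < Real.log 1536 := Real.log_pos (by norm_num)
  have hl2 : 0 < Real.log 2 := Real.log_pos (by norm_num)
  have key : Real.log ((1536 * D) ^ (1025 * D) : ℝ) < Real.log (2 ^ (s + 1) : ℝ) := by
    rw [Real.log_pow, Real.log_pow, Real.log_mul (by norm_num) hD'.ne']
    push_cast
    calc 1025 * D * (Real.log 1536 + Real.log D)
        ≤ 1025 * Real.exp (c * Real.log s) * (Real.log 1536 + c * Real.log s) := by gcongr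
      _ < s * Real.log 2 := h
      _ ≤ (s + 1) * Real.log 2 := by gcongr; linarith
  have := (Real.log_lt_log_iff (by positivity) (by positivity)).1 key
  exact_mod_cast this

end OddZeta

theorem stmt1 (ε : ℝ) (hε : 0 < ε) :
    ∃ S : ℕ, ∀ s : ℕ, Odd s → S ≤ s →
      (2 : ℝ) ^ ((1 - ε) * Real.log s / Real.log (Real.log s)) ≤
        ({i : ℕ | Odd i ∧ 3 ≤ i ∧ i ≤ s ∧ Irrational (zetaVal i)}.ncard : ℝ) := by
  set c : ℝ := 1 - min ε 1 / 2 with hc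
  have hm0 : 0 < min ε 1 := lt_min hε one_pos
  have hm1 : min ε 1 ≤ 1 := min_le_right _ _
  have hmε : min ε 1 ≤ ε := min_le_left _ _
  have hev : ∀ᶠ s : ℕ in Filter.atTop, _ := (Real.tendsto_log_atTop.comp
    tendsto_natCast_atTop_atTop).eventually
      (((OddZeta.eventually_exists_primorial (c := c) (by linarith) (by linarith)).and
        (OddZeta.eventually_le_of_mul_le (c := c) (c' := 1 - ε) (by linarith))).and
        (OddZeta.eventually_linear_mul_exp_lt (c := c) (by linarith)))
  obtain ⟨S, hS⟩ := Filter.eventually_atTop.1 (hev.and (Filter.eventually_gt_atTop 0))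
  refine ⟨S, fun s hs hSs => ?_⟩
  obtain ⟨⟨⟨⟨N, hN2, hNle, hNge⟩, hx⟩, hexp⟩, hs0⟩ := hS s hSs
  simp only [Function.comp_apply] at hNle hNge hx hexp
  have hD0 := primorial_pos N
  have hD : Even (primorial N) :=
    even_iff_two_dvd.2 ((Nat.prime_two.dvd_primorial_iff).2 hN2)
  have hcard := OddZeta.card_divisors_le_card_irrational hD hD0 hs.add_one
    (OddZeta.pow_lt_two_pow_of_log_le hD0 hs0 hNle hexp)
  classical
  have hset : {i : ℕ | Odd i ∧ 3 ≤ i ∧ i ≤ s ∧ Irrational (zetaVal i)} =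
      ((Finset.Icc 3 (s + 1 - 1)).filter fun i => Odd i ∧ Irrational (zetaVal i) : Finset ℕ) := by
    ext i
    simp only [Set.mem_ofPred_eq, Finset.coe_filter, Finset.mem_Icc, Nat.add_sub_cancel]
    tauto
  rw [hset, Set.ncard_coe_finset]
  calc (2 : ℝ) ^ ((1 - ε) * Real.log s / Real.log (Real.log s))
      ≤ (2 : ℝ) ^ (Nat.primeCounting N : ℝ) :=
        Real.rpow_le_rpow_of_exponent_le (by norm_num) (hx _ hNge)
    _ = ((2 ^ Nat.primeCounting N : ℕ) : ℝ) := by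
      rw [Real.rpow_natCast]
      push_cast
      rfl
    _ ≤ _ := by exact_mod_cast (OddZeta.two_pow_primeCounting_le_card_divisors N).trans hcard
end

section
/- Let s, D, n be positive integers with s odd, s ≥ 3D, and Dn even, and let a_{i,k} (1 ≤ i ≤ s, 0 ≤ k ≤ n) be rational numbers such that R_n(t) = Σ_{i=1}^{s} Σ_{k=0}^{n} a_{i,k}/(t+k)^i for every real t ∉ {0, -1, …, -n}. Then for every j ∈ {1, …, D}, the rational number d_{n+1}^{s+1} · ρ_{0,j} is an integer, where ρ_{0,j} = -Σ_{k=0}^{n} Σ_{ℓ=0}^{k} Σ_{i=1}^{s} a_{i,k}/(ℓ + j/D)^i and d_{n+1} = lcm(1, 2, …, n+1). -/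
/-- The rational function `R_n(t)` of Fischler–Sprang–Zudilin (depending on `s` and `D`). -/
noncomputable def R (s D n : ℕ) (t : ℝ) : ℝ :=
  (D : ℝ) ^ (3 * D * n) * (n.factorial : ℝ) ^ (s + 1 - 3 * D) *
    (∏ j ∈ Finset.range (3 * D * n + 1), (t - n + (j : ℝ) / D)) /
    (∏ j ∈ Finset.range (n + 1), (t + j)) ^ (s + 1)

/-- `d_m = lcm(1, 2, …, m)`. -/
def dd (m : ℕ) : ℕ := (Finset.Icc 1 m).lcm id

open Polynomial in
/-- Solving a truncated power series equation preserves integrality of coefficients. -/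
theorem Polynomial.coeff_mem_of_mul_add_X_pow {K : Type*} [Field K] (A : ValuationSubring K)
    {N : ℕ} {M Q T W : K[X]} (hM : ∀ i, M.coeff i ∈ A) (hQ : ∀ i, Q.coeff i ∈ A)
    (hQ0 : Q.coeff 0 = 1) (h : M = T * Q + X ^ N * W) : ∀ i < N, T.coeff i ∈ A := by
  intro i
  induction i using Nat.strong_induction_on with
  | _ i ih =>
    intro hi
    have hc : M.coeff i = ∑ x ∈ Finset.range i, T.coeff x * Q.coeff (i - x) + T.coeff i := by
      rw [h, coeff_add, coeff_X_pow_mul', if_neg (by omega), add_zero, coeff_mul,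
        Finset.Nat.sum_antidiagonal_eq_sum_range_succ_mk, Finset.sum_range_succ]
      simp [hQ0]
    rw [eq_sub_of_add_eq' hc.symm]
    refine sub_mem (hM i) (sum_mem fun x hx => mul_mem (ih x ?_ ?_) (hQ _)) <;>
      have := Finset.mem_range.1 hx <;> omega

open Polynomial in
theorem Polynomial.eval_mem_valuationSubring {K : Type*} [Field K] (A : ValuationSubring K)
    {P : K[X]} (hP : ∀ i, P.coeff i ∈ A) {y : K} (hy : y ∈ A) : P.eval y ∈ A := by
  rw [eval_eq_sum_range]
  exact sum_mem fun i _ => mul_mem (hP i) (pow_mem hy i)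

open Polynomial in
theorem Polynomial.eval_div_pow_mem_valuationSubring {K : Type*} [Field K] (A : ValuationSubring K)
    {N : ℕ} {M Q T W : K[X]} (hM : ∀ i, M.coeff i ∈ A) (hQ : ∀ i, Q.coeff i ∈ A)
    (hQ0 : Q.coeff 0 = 1) (hT : T.natDegree < N) (h : M = T * Q + X ^ N * W)
    {y : K} (hy : y ≠ 0) (hMy : M.eval y = 0) : T.eval y / y ^ N ∈ A := by
  have hTA : ∀ i, T.coeff i ∈ A := fun i => by
    rcases lt_or_ge i N with hi | hi
    · exact coeff_mem_of_mul_add_X_pow A hM hQ hQ0 h i hi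
    · rw [coeff_eq_zero_of_natDegree_lt (by omega)]
      exact zero_mem _
  by_cases hyA : y⁻¹ ∈ A
  · rw [eval_eq_sum_range, Finset.sum_div]
    refine sum_mem fun i hi => ?_
    have hi' : i ≤ N := by have := Finset.mem_range.1 hi; omega
    have : T.coeff i * y ^ i / y ^ N = T.coeff i * y⁻¹ ^ (N - i) := by
      obtain ⟨c, rfl⟩ := Nat.exists_eq_add_of_le hi'
      rw [Nat.add_sub_cancel_left, pow_add, inv_pow]
      field_simp
    rw [this]
    exact mul_mem (hTA i) (pow_mem hyA _)
  · have hymem : y ∈ A := (A.mem_or_inv_mem y).resolve_right hyA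
    have hWA : ∀ i, W.coeff i ∈ A := fun i => by
      have : W.coeff i = M.coeff (i + N) - (T * Q).coeff (i + N) := by
        rw [h, coeff_add, coeff_X_pow_mul, add_sub_cancel_left]
      rw [this, coeff_mul]
      exact sub_mem (hM _) (sum_mem fun x _ => mul_mem (hTA _) (hQ _))
    have hdiv : Q.eval y = 1 + y * Q.divX.eval y := by
      conv_lhs => rw [← Q.X_mul_divX_add, hQ0]
      simp [add_comm]
    have hD : Q.divX.eval y ∈ A := eval_mem_valuationSubring A
      (fun i => by rw [coeff_divX]; exact hQ _) hymem
    have hval : A.valuation (Q.eval y) = 1 := by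
      have hy1 : A.valuation y < 1 :=
        A.mem_nonunits_iff.1 (A.mem_nonunits_iff_or.2 (Or.inr hyA))
      have hyd : A.valuation (y * Q.divX.eval y) < 1 := by
        rw [map_mul]
        exact mul_lt_one_of_lt_of_le hy1 ((A.valuation_le_one_iff _).2 hD)
      rw [hdiv]
      exact A.valuation.map_one_add_of_lt hyd
    have hQne : Q.eval y ≠ 0 := fun h0 => by simp [h0] at hval
    have hQinv : (Q.eval y)⁻¹ ∈ A := by
      rw [← A.valuation_le_one_iff, map_inv₀, hval, inv_one]
    have he : T.eval y / y ^ N = -(W.eval y * (Q.eval y)⁻¹) := by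
      have := hMy
      rw [h] at this
      simp only [eval_add, eval_mul, eval_pow, eval_X] at this
      field_simp
      linear_combination this
    rw [he]
    exact neg_mem (mul_mem (eval_mem_valuationSubring A hWA hymem) hQinv)

theorem Rat.exists_int_of_forall_mem_valuationSubring {x : ℚ}
    (hx : ∀ A : ValuationSubring ℚ, x ∈ A) : ∃ z : ℤ, (z : ℚ) = x := by
  have h : x ∈ (⨅ V : {V : ValuationSubring ℚ // (∅ : Set ℚ) ⊆ V.toSubring}, V.1.toSubring) := by
    simp only [Subring.mem_iInf]
    exact fun V => hx V
  rw [iInf_valuationSubring_superset] at h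
  have : Algebra.IsIntegral ℤ (Subring.closure (∅ : Set ℚ)) := ⟨fun y => by
    obtain ⟨y, hy⟩ := y
    rw [Subring.closure_empty, Subring.mem_bot] at hy
    obtain ⟨z, rfl⟩ := hy
    exact isIntegral_algebraMap (R := ℤ) (x := z)⟩
  exact IsIntegrallyClosed.isIntegral_iff.1
    (isIntegral_trans (R := ℤ) (A := Subring.closure (∅ : Set ℚ)) x h)

open Polynomial in
/-- If `T` is the truncation of `M / Q` modulo `X ^ N`, with `M` and `Q` integral and `Q(0) = 1`,
then `T(y) / y ^ N` is an integer at every nonzero rational root `y` of `M`. -/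
theorem Polynomial.eval_div_pow_isInt {N : ℕ} {M Q T W : ℚ[X]}
    (hM : M ∈ lifts (Int.castRingHom ℚ)) (hQ : Q ∈ lifts (Int.castRingHom ℚ))
    (hQ0 : Q.coeff 0 = 1) (hT : T.natDegree < N) (h : M = T * Q + X ^ N * W)
    {y : ℚ} (hy : y ≠ 0) (hMy : M.eval y = 0) : ∃ z : ℤ, (z : ℚ) = T.eval y / y ^ N := by
  refine Rat.exists_int_of_forall_mem_valuationSubring fun A => ?_
  rw [lifts_iff_coeff_lifts] at hM hQ
  refine eval_div_pow_mem_valuationSubring A (fun i => ?_) (fun i => ?_) hQ0 hT h hy hMy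
  · obtain ⟨z, hz⟩ := hM i
    rw [← hz]
    exact intCast_mem A z
  · obtain ⟨z, hz⟩ := hQ i
    rw [← hz]
    exact intCast_mem A z

open Polynomial in
theorem Ring.factorial_mul_choose_eq_prod {A : Type*} [CommRing A] [BinomialRing A]
    (r : A) (n : ℕ) : (n.factorial : A) * Ring.choose r n = ∏ i ∈ Finset.range n, (r - i) := by
  rw [← nsmul_eq_mul, ← Ring.descPochhammer_eq_factorial_smul_choose]
  induction n with
  | zero => simp
  | succ n ih =>
    rw [descPochhammer_succ_right, smeval_mul, ih, Finset.prod_range_succ]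
    simp [smeval_sub, smeval_natCast]

open Polynomial in
theorem Polynomial.choose_mem_lifts {u : ℚ[X]} {n : ℕ}
    (hu : ∀ m, 1 ≤ m → m ≤ n → C ((m : ℚ)⁻¹) * u ∈ lifts (Int.castRingHom ℚ)) {j : ℕ} (hj : j ≤ n) :
    Ring.choose u j ∈ lifts (Int.castRingHom ℚ) := by
  cases j with
  | zero => simp
  | succ j =>
    have key : Ring.choose u (j + 1) =
        (∏ i ∈ Finset.range j, (C (((i + 1 : ℕ) : ℚ)⁻¹) * u - 1)) *
          (C (((j + 1 : ℕ) : ℚ)⁻¹) * u) := by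
      have hne : (((j + 1).factorial : ℕ) : ℚ[X]) ≠ 0 :=
        Nat.cast_ne_zero.2 (Nat.factorial_ne_zero _)
      apply mul_left_cancel₀ hne
      rw [Ring.factorial_mul_choose_eq_prod, Finset.prod_range_succ',
        ← Finset.prod_range_add_one_eq_factorial, Finset.prod_range_succ, Nat.cast_mul,
        Nat.cast_prod, mul_mul_mul_comm, ← Finset.prod_mul_distrib]
      have hC (i : ℕ) : ((i + 1 : ℕ) : ℚ[X]) * C (((i + 1 : ℕ) : ℚ)⁻¹) = 1 := by
        rw [← C_eq_natCast, ← C_mul, mul_inv_cancel₀ (by positivity), C_1]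
      congr 1
      · refine Finset.prod_congr rfl fun i _ => ?_
        rw [mul_sub, ← mul_assoc, hC]
        ring
      · rw [← mul_assoc, hC]
        simp
    rw [key]
    rw [lifts_iff_liftsRing]
    refine mul_mem (prod_mem fun i hi => sub_mem ?_ (one_mem _)) ?_ <;>
      rw [← lifts_iff_liftsRing]
    · have := Finset.mem_range.1 hi
      exact hu _ (by omega) (by omega)
    · exact hu _ (by omega) (by omega)

open Polynomial in
theorem Polynomial.prod_add_mem_lifts {u : ℚ[X]} {n : ℕ}
    (hu : ∀ m, 1 ≤ m → m ≤ n → C ((m : ℚ)⁻¹) * u ∈ lifts (Int.castRingHom ℚ)) (c : ℤ) :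
    C ((n.factorial : ℚ)⁻¹) * ∏ i ∈ Finset.range n, (u + C ((c : ℚ) + i + 1)) ∈
      lifts (Int.castRingHom ℚ) := by
  have key : C ((n.factorial : ℚ)⁻¹) * ∏ i ∈ Finset.range n, (u + C ((c : ℚ) + i + 1)) =
      Ring.choose (u + ((c + n : ℤ) : ℚ[X])) n := by
    have hne : ((n.factorial : ℕ) : ℚ[X]) ≠ 0 := Nat.cast_ne_zero.2 (Nat.factorial_ne_zero _)
    apply mul_left_cancel₀ hne
    rw [Ring.factorial_mul_choose_eq_prod, ← mul_assoc, ← C_eq_natCast, ← C_mul,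
      mul_inv_cancel₀ (Nat.cast_ne_zero.2 (Nat.factorial_ne_zero _)), C_1, one_mul,
      ← Finset.prod_range_reflect]
    refine Finset.prod_congr rfl fun i hi => ?_
    have : i < n := Finset.mem_range.1 hi
    rw [Nat.sub_sub, Nat.cast_sub (by omega)]
    simp
    ring
  rw [key, Ring.add_choose_eq n (Commute.all _ _)]
  refine sum_mem fun x hx => mul_mem (choose_mem_lifts hu ?_) ?_
  · exact Finset.HasAntidiagonal.antidiagonal.fst_le hx
  · refine (mem_lifts _).2 ⟨((Ring.choose (c + n) x.2 : ℤ) : ℤ[X]), ?_⟩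
    rw [Polynomial.map_intCast]
    exact Ring.map_choose (Int.castRingHom ℚ[X]) (c + n) x.2

theorem pow_mul_prod_range_add_div {K : Type*} [Field K] {D : K} (hD : D ≠ 0) (t : K) (n B : ℕ) :
    D ^ (B * n) * ∏ j ∈ Finset.range (B * n + 1), (t + (j : K) / D) =
      t * ∏ b ∈ Finset.range B, ∏ i ∈ Finset.range n, (D * t + ((b : K) * n + i + 1)) := by
  induction B with
  | zero => simp
  | succ B ih =>
    rw [Finset.prod_range_succ _ B, ← mul_assoc, ← ih, show (B + 1) * n + 1 = B * n + 1 + n by ring,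
      Finset.prod_range_add, Nat.succ_mul, pow_add]
    have : ∏ i ∈ Finset.range n, (D * t + ((B : K) * n + i + 1)) =
        D ^ n * ∏ i ∈ Finset.range n, (t + ((B * n + 1 + i : ℕ) : K) / D) := by
      rw [← Finset.card_range n, ← Finset.prod_const, Finset.card_range, ← Finset.prod_mul_distrib]
      refine Finset.prod_congr rfl fun i _ => ?_
      push_cast
      field_simp
      ring
    rw [this]
    ring

theorem exists_int_mul_prod_erase_sub_eq_factorial {n k : ℕ} (hk : k ≤ n) :
    ∃ z : ℤ, (z : ℚ) * ∏ m ∈ (Finset.range (n + 1)).erase k, ((m : ℚ) - k) = n.factorial := by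
  obtain ⟨r, rfl⟩ := Nat.exists_eq_add_of_le hk
  have hP : ∏ m ∈ (Finset.range (k + r + 1)).erase k, ((m : ℚ) - k) =
      (-1) ^ k * k.factorial * r.factorial := by
    have h1 : ∏ m ∈ (Finset.range (k + r + 1)).erase k, ((m : ℚ) - k) =
        ∏ m ∈ Finset.range (k + r + 1), if m = k then (1 : ℚ) else (m : ℚ) - k :=
      (Finset.prod_congr rfl fun m hm => (if_neg (Finset.ne_of_mem_erase hm)).symm).trans
        (Finset.prod_erase _ (if_pos rfl))
    rw [h1, add_assoc, Finset.prod_range_add, Finset.prod_range_succ']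
    congr 1
    · rw [← Finset.prod_range_reflect, ← Finset.prod_range_add_one_eq_factorial, Nat.cast_prod,
        ← Finset.card_range k, ← Finset.prod_const, Finset.card_range, ← Finset.prod_mul_distrib]
      refine Finset.prod_congr rfl fun m hm => ?_
      have := Finset.mem_range.1 hm
      rw [if_neg (by omega), Nat.sub_sub, Nat.cast_sub (by omega)]
      push_cast
      ring
    · rw [← Finset.prod_range_add_one_eq_factorial, Nat.cast_prod]
      simp
  refine ⟨(-1) ^ k * (k + r).choose r, ?_⟩
  rw [hP, ← Nat.add_choose_mul_factorial_mul_factorial k r]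
  push_cast
  rw [show ∀ a b c e : ℚ, e * a * (e * b * c) = e * e * (a * b * c) by intros; ring,
    ← mul_pow]
  simp

open Polynomial in
theorem exists_int_eq_pow_mul_sum_div_pow {s D n d k : ℕ} (hd : ∀ m, 1 ≤ m → m ≤ n → m ∣ d)
    (hd0 : 0 < d) (hk : k ≤ n) (hD : 0 < D) (hsD : 3 * D ≤ s) {a : ℕ → ℕ → ℚ}
    (ha : ∀ t : ℚ, 0 < t → (D : ℚ) ^ (3 * D * n) * (n.factorial : ℚ) ^ (s + 1 - 3 * D) *
        (∏ j ∈ Finset.range (3 * D * n + 1), (t - n + (j : ℚ) / D)) /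
        (∏ j ∈ Finset.range (n + 1), (t + j)) ^ (s + 1) =
      ∑ i ∈ Finset.Icc 1 s, ∑ k ∈ Finset.range (n + 1), a i k / (t + k) ^ i)
    {x : ℚ} (hx : x ≠ 0)
    (hx0 : ∏ j ∈ Finset.range (3 * D * n + 1), (x - k - n + (j : ℚ) / D) = 0) :
    ∃ z : ℤ, (z : ℚ) = (d : ℚ) ^ (s + 1) * ∑ i ∈ Finset.Icc 1 s, a i k / x ^ i := by
  have hdq : (d : ℚ) ≠ 0 := by positivity
  have hDq : (D : ℚ) ≠ 0 := by positivity
  have hnq : (n.factorial : ℚ) ≠ 0 := by positivity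
  set E := (Finset.range (n + 1)).erase k with hE
  set q : ℕ → ℚ := fun m => (m : ℚ) - k with hq
  have hqE : ∀ m ∈ E, q m ≠ 0 := fun m hm =>
    sub_ne_zero.2 (Nat.cast_injective.ne (Finset.ne_of_mem_erase hm))
  obtain ⟨B, hB⟩ := exists_int_mul_prod_erase_sub_eq_factorial hk
  rw [← hE] at hB
  set P : ℚ := ∏ m ∈ E, q m with hP
  have hP0 : P ≠ 0 := Finset.prod_ne_zero_iff.2 hqE
  set L : ℕ → ℚ[X] := fun m => 1 + C ((d : ℚ) / q m) * X with hL
  set Q : ℚ[X] := ∏ m ∈ E, L m ^ (s + 1) with hQ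
  set T : ℚ[X] := ∑ i ∈ Finset.Icc 1 s, C (a i k * (d : ℚ) ^ (s + 1 - i)) * X ^ (s + 1 - i) with hT
  set W : ℚ[X] := C ((d : ℚ) ^ (s + 1)) * ∑ i ∈ Finset.Icc 1 s, ∑ m ∈ E,
    C (a i m / q m ^ i) * (L m ^ (s + 1 - i) * ∏ m' ∈ E.erase m, L m' ^ (s + 1)) with hW
  set c : ℕ → ℤ := fun b => -(D * (k + n) : ℤ) + b * n with hc
  set M : ℚ[X] := (B : ℚ[X]) ^ (s + 1) * ((d : ℚ[X]) * X - ((k + n : ℕ) : ℚ[X])) *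
    ∏ b ∈ Finset.range (3 * D), (C ((n.factorial : ℚ)⁻¹) *
      ∏ i ∈ Finset.range n, (C ((D * d : ℕ) : ℚ) * X + C ((c b : ℚ) + i + 1))) with hM
  have hMeval (y : ℚ) : M.eval y = (B : ℚ) ^ (s + 1) * ((n.factorial : ℚ)⁻¹) ^ (3 * D) *
      ((D : ℚ) ^ (3 * D * n) * ∏ j ∈ Finset.range (3 * D * n + 1),
        (d * y - k - n + (j : ℚ) / D)) := by
    rw [pow_mul_prod_range_add_div hDq]
    simp only [hM, eval_mul, eval_pow, eval_sub, eval_intCast, eval_natCast, eval_X, eval_prod,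
      eval_add, eval_C, Finset.prod_mul_distrib, Finset.prod_const, Finset.card_range]
    have : ∀ b i : ℕ, ((D * d : ℕ) : ℚ) * y + ((c b : ℚ) + i + 1) =
        D * (d * y - k - n) + ((b : ℚ) * n + i + 1) := fun b i => by
      simp only [hc]
      push_cast
      ring
    simp only [this]
    push_cast
    ring
  have hMl : M ∈ lifts (Int.castRingHom ℚ) := by
    rw [lifts_iff_liftsRing]
    have hXl : (X : ℚ[X]) ∈ liftsRing (Int.castRingHom ℚ) := by
      rw [← lifts_iff_liftsRing]
      exact X_mem_lifts _
    refine mul_mem (mul_mem (pow_mem (intCast_mem _ _) _)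
      (sub_mem (mul_mem (natCast_mem _ _) hXl) (natCast_mem _ _))) (prod_mem fun b _ => ?_)
    rw [← lifts_iff_liftsRing]
    refine prod_add_mem_lifts (fun m h1 hm => ?_) _
    obtain ⟨e, rfl⟩ := hd m h1 hm
    refine (mem_lifts _).2 ⟨C ((D * e : ℕ) : ℤ) * X, ?_⟩
    have : (m : ℚ) ≠ 0 := by positivity
    rw [← mul_assoc, ← C_mul, Polynomial.map_mul, map_C, map_X]
    congr 2
    simp
    field_simp
  have hQl : Q ∈ lifts (Int.castRingHom ℚ) := by
    refine prod_mem fun m hm => pow_mem (add_mem (one_mem _) ?_) _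
    have hm' : m < n + 1 := Finset.mem_range.1 (Finset.mem_of_mem_erase hm)
    have hmk : m ≠ k := Finset.ne_of_mem_erase hm
    have hdvd : ((m : ℤ) - k) ∣ (d : ℤ) := by
      rw [← Int.natAbs_dvd_natAbs, Int.natAbs_natCast]
      exact hd _ (by omega) (by omega)
    obtain ⟨e, he⟩ := hdvd
    refine (mem_lifts _).2 ⟨C e * X, ?_⟩
    rw [Polynomial.map_mul, map_C, map_X]
    congr 2
    rw [eq_div_iff (hqE m hm)]
    have : (d : ℚ) = ((m : ℚ) - k) * e := by exact_mod_cast he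
    rw [this]
    simp [hq, mul_comm]
  have hQ0 : Q.coeff 0 = 1 := by
    rw [coeff_zero_eq_eval_zero]
    simp [hQ, hL, eval_prod]
  have hTdeg : T.natDegree < s + 1 := by
    refine Nat.lt_succ_of_le (natDegree_sum_le_of_forall_le _ _ fun i hi => ?_)
    have := Finset.mem_Icc.1 hi
    exact (natDegree_C_mul_X_pow_le _ _).trans (by omega)
  have hMTW : M = T * Q + X ^ (s + 1) * W := by
    refine eq_of_infinite_eval_eq _ _ (Set.infinite_of_injective_forall_mem
      (f := fun y : ℕ => ((n + 1 + y : ℕ) : ℚ)) (fun y z h => by simpa using h) fun u => ?_)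
    set y : ℚ := ((n + 1 + u : ℕ) : ℚ) with hy
    have hy0 : 0 < y := by positivity
    have hkdy : (k : ℚ) < d * y := by
      rw [hy]
      norm_cast
      nlinarith
    have hqL : ∀ m ∈ E, d * y - k + m = q m * (L m).eval y := fun m hm => by
      have := hqE m hm
      simp only [hL, eval_add, eval_one, eval_mul, eval_C, eval_X]
      field_simp
      simp only [hq]
      ring
    have hLy : ∀ m ∈ E, (L m).eval y ≠ 0 := fun m hm h0 => by
      have := hqL m hm
      rw [h0, mul_zero] at this
      have hm0 : (0 : ℚ) ≤ m := by positivity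
      linarith
    have hprod : ∏ m ∈ Finset.range (n + 1), (d * y - k + (m : ℚ)) =
        d * y * (P * ∏ m ∈ E, (L m).eval y) := by
      rw [← Finset.mul_prod_erase _ _ (Finset.mem_range.2 (Nat.lt_succ_of_le hk)), ← hE,
        Finset.prod_congr rfl hqL, Finset.prod_mul_distrib, sub_add_cancel]
    have hQy : Q.eval y = (∏ m ∈ E, (L m).eval y) ^ (s + 1) := by
      simp only [hQ, eval_prod, eval_pow, Finset.prod_pow]
    have hLprod : ∏ m ∈ E, (L m).eval y ≠ 0 := Finset.prod_ne_zero_iff.2 hLy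
    have hR := ha (d * y - k) (by linarith)
    rw [hprod] at hR
    have hlhs : M.eval y = (d * y) ^ (s + 1) * Q.eval y *
        ∑ i ∈ Finset.Icc 1 s, ∑ m ∈ Finset.range (n + 1), a i m / (d * y - k + m) ^ i := by
      rw [← hR, hMeval, hQy]
      have hBP : (B : ℚ) = n.factorial / P := by rw [eq_div_iff hP0, hB]
      have hpow : (n.factorial : ℚ) ^ (s + 1) =
          (n.factorial : ℚ) ^ (s + 1 - 3 * D) * (n.factorial : ℚ) ^ (3 * D) := by
        rw [← pow_add, Nat.sub_add_cancel (by omega)]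
      rw [hBP, div_pow, hpow]
      simp only [mul_pow, inv_pow]
      field_simp
    show M.eval y = (T * Q + X ^ (s + 1) * W).eval y
    rw [hlhs]
    simp only [eval_add, eval_mul, eval_pow, eval_X, hT, hW, eval_finsetSum, eval_C, eval_prod]
    rw [Finset.sum_mul, ← mul_assoc, Finset.mul_sum, Finset.mul_sum, ← Finset.sum_add_distrib]
    refine Finset.sum_congr rfl fun i hi => ?_
    have hi' : i ≤ s + 1 := by have := Finset.mem_Icc.1 hi; omega
    rw [← Finset.add_sum_erase _ _ (Finset.mem_range.2 (Nat.lt_succ_of_le hk)), ← hE, mul_add,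
      Finset.mul_sum, Finset.mul_sum]
    have hsplit (z : ℚ) : z ^ (s + 1) = z ^ (s + 1 - i) * z ^ i := by
      rw [← pow_add, Nat.sub_add_cancel hi']
    congr 1
    · rw [sub_add_cancel, hsplit (d * y)]
      simp only [mul_pow]
      field_simp
    · refine Finset.sum_congr rfl fun m hm => ?_
      have h1 := hqE m hm
      have h2 := hLy m hm
      have hQm : Q.eval y = (L m).eval y ^ (s + 1) *
          ∏ m' ∈ E.erase m, (L m').eval y ^ (s + 1) := by
        simp only [hQ, eval_prod, eval_pow]
        exact (Finset.mul_prod_erase _ _ hm).symm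
      rw [hqL m hm, hQm, hsplit ((L m).eval y)]
      simp only [mul_pow]
      field_simp
  have hroot : M.eval (x / d) = 0 := by
    rw [hMeval, mul_div_cancel₀ _ hdq, hx0]
    simp
  obtain ⟨z, hz⟩ := eval_div_pow_isInt hMl hQl hQ0 hTdeg hMTW (div_ne_zero hx hdq) hroot
  refine ⟨z, hz.trans ?_⟩
  simp only [hT, eval_finsetSum, eval_mul, eval_pow, eval_C, eval_X]
  rw [Finset.sum_div, Finset.mul_sum]
  refine Finset.sum_congr rfl fun i hi => ?_
  have hi' : i ≤ s + 1 := by have := Finset.mem_Icc.1 hi; omega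
  obtain ⟨e, he⟩ := Nat.exists_eq_add_of_le hi'
  rw [he, Nat.add_sub_cancel_left, div_pow, div_pow, pow_add, pow_add]
  field_simp

theorem stmt5 (s D n : ℕ) (hs : Odd s) (hD : 0 < D) (hn : 0 < n) (hsD : 3 * D ≤ s)
    (hDn : Even (D * n)) (a : ℕ → ℕ → ℚ)
    (ha : ∀ t : ℝ, (∀ k : ℕ, k ≤ n → t ≠ -(k : ℝ)) →
      R s D n t = ∑ i ∈ Finset.Icc 1 s, ∑ k ∈ Finset.range (n + 1), (a i k : ℝ) / (t + k) ^ i)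
    (j : ℕ) (hj : 1 ≤ j) (hjD : j ≤ D) :
    ∃ z : ℤ, (dd (n + 1) : ℚ) ^ (s + 1) *
      (-(∑ k ∈ Finset.range (n + 1), ∑ l ∈ Finset.range (k + 1), ∑ i ∈ Finset.Icc 1 s,
          a i k / ((l : ℚ) + (j : ℚ) / D) ^ i)) = (z : ℚ) := by
  have hd : ∀ m, 1 ≤ m → m ≤ n → m ∣ dd (n + 1) := fun m h1 hm =>
    Finset.dvd_lcm (f := id) (Finset.mem_Icc.2 ⟨h1, by omega⟩)
  have hd0 : 0 < dd (n + 1) := Nat.pos_of_ne_zero fun h => by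
    obtain ⟨m, hm, h0⟩ := Finset.lcm_eq_zero_iff.1 h
    have := Finset.mem_Icc.1 hm
    simp only [id] at h0
    omega
  have haq : ∀ t : ℚ, 0 < t → (D : ℚ) ^ (3 * D * n) * (n.factorial : ℚ) ^ (s + 1 - 3 * D) *
        (∏ j ∈ Finset.range (3 * D * n + 1), (t - n + (j : ℚ) / D)) /
        (∏ j ∈ Finset.range (n + 1), (t + j)) ^ (s + 1) =
      ∑ i ∈ Finset.Icc 1 s, ∑ k ∈ Finset.range (n + 1), a i k / (t + k) ^ i := fun t ht => by
    have htR : (0 : ℝ) < t := by exact_mod_cast ht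
    have h := ha t fun k _ h => by
      have : (0 : ℝ) ≤ k := by positivity
      linarith
    rw [R] at h
    apply Rat.cast_injective (α := ℝ)
    push_cast
    exact h
  have hDq : (D : ℚ) ≠ 0 := by positivity
  have key : ∀ k ∈ Finset.range (n + 1), ∀ l ∈ Finset.range (k + 1), ∃ z : ℤ,
      (z : ℚ) = (dd (n + 1) : ℚ) ^ (s + 1) *
        ∑ i ∈ Finset.Icc 1 s, a i k / ((l : ℚ) + (j : ℚ) / D) ^ i := fun k hk l hl => by
    have hk' : k ≤ n := Nat.lt_succ_iff.1 (Finset.mem_range.1 hk)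
    have hl' : l ≤ k := Nat.lt_succ_iff.1 (Finset.mem_range.1 hl)
    refine exists_int_eq_pow_mul_sum_div_pow hd hd0 hk' hD hsD haq (by positivity) ?_
    obtain ⟨e, rfl⟩ := Nat.exists_eq_add_of_le hl'
    have hle : j ≤ D * (e + n) := hjD.trans (Nat.le_mul_of_pos_right _ (by omega))
    refine Finset.prod_eq_zero (i := D * (e + n) - j) (Finset.mem_range.2 ?_) ?_
    · have : D * (e + n) ≤ D * (2 * n) := Nat.mul_le_mul_left _ (by omega)
      have h3 : D * (2 * n) ≤ 3 * D * n := by nlinarith [Nat.zero_le (D * n)]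
      omega
    · rw [Nat.cast_sub hle]
      push_cast
      field_simp
      ring
  choose! f hf using key
  refine ⟨-∑ k ∈ Finset.range (n + 1), ∑ l ∈ Finset.range (k + 1), f k l, ?_⟩
  push_cast
  rw [mul_neg, Finset.mul_sum]
  congr 1
  refine Finset.sum_congr rfl fun k hk => ?_
  rw [Finset.mul_sum]
  exact Finset.sum_congr rfl fun l hl => (hf k hk l hl).symm
end

section
/- There exists a constant C > 0 with the following property. Let s and D be positive integers with s odd, s ≥ 3D, and s/(D·log D) ≥ C (with the convention that this holds automatically when D = 1). Let n range over positive integers with Dn even, and for j ∈ {1, …, D} set r_{n,j} = Σ_{m=1}^{∞} R_n(m + j/D). Then for every j ∈ {1, …, D}, lim_{n→∞, Dn even} (r_{n,j})^{1/n} = g(x_0), where x_0 is the unique positive real root of (X+3)^D (X+1)^{s+1} - X^D (X+2)^{s+1} and g(x) = D^{3D} · (x+3)^{3D} (x+1)^{s+1} / (x+2)^{2(s+1)}. -/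
open Filter Topology

/-- The primitive `x log x - x` of the logarithm. -/
noncomputable def logPrim (x : ℝ) : ℝ := x * Real.log x - x

lemma log_le_logPrim_sub {a : ℝ} (ha : 0 < a) :
    Real.log a ≤ logPrim (a + 1) - logPrim a := by
  have h := Real.log_le_sub_one_of_pos (div_pos ha (by linarith : 0 < a + 1))
  rw [Real.log_div (by positivity) (by positivity)] at h
  have h2 : (a + 1) * (Real.log a - Real.log (a + 1)) ≤ (a + 1) * (a / (a + 1) - 1) :=
    mul_le_mul_of_nonneg_left h (by linarith)
  have h3 : (a + 1) * (a / (a + 1) - 1) = -1 := by field_simp; ring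
  unfold logPrim
  linarith

lemma logPrim_sub_le_log {a : ℝ} (ha : 0 < a) :
    logPrim (a + 1) - logPrim a ≤ Real.log (a + 1) := by
  have h := Real.log_le_sub_one_of_pos (div_pos (by linarith : 0 < a + 1) ha)
  rw [Real.log_div (by positivity) (by positivity)] at h
  have h2 : a * (Real.log (a + 1) - Real.log a) ≤ a * ((a + 1) / a - 1) :=
    mul_le_mul_of_nonneg_left h ha.le
  have h3 : a * ((a + 1) / a - 1) = 1 := by field_simp; ring
  unfold logPrim
  linarith

lemma sum_log_le {a : ℝ} (ha : 0 < a) (N : ℕ) :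
    ∑ i ∈ Finset.range (N + 1), Real.log (a + i) ≤
      logPrim (a + N) - logPrim a + Real.log (a + N) := by
  induction N with
  | zero => simp
  | succ N ih =>
    rw [Finset.sum_range_succ]
    have h := log_le_logPrim_sub (by positivity : 0 < a + (N : ℝ))
    push_cast
    rw [← add_assoc]
    linarith

lemma le_sum_log {a : ℝ} (ha : 0 < a) (N : ℕ) :
    logPrim (a + N) - logPrim a + Real.log a ≤
      ∑ i ∈ Finset.range (N + 1), Real.log (a + i) := by
  induction N with
  | zero => simp
  | succ N ih =>
    rw [Finset.sum_range_succ]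
    have h := logPrim_sub_le_log (by positivity : 0 < a + (N : ℝ))
    push_cast
    rw [← add_assoc]
    linarith

lemma log_factorial_eq_sum (n : ℕ) :
    Real.log ((n + 1).factorial : ℝ) = ∑ i ∈ Finset.range (n + 1), Real.log (1 + i) := by
  induction n with
  | zero => simp
  | succ n ih =>
    rw [Finset.sum_range_succ, ← ih, Nat.factorial_succ]
    push_cast
    rw [Real.log_mul (by positivity) (by positivity)]
    ring_nf

lemma log_factorial_le {n : ℕ} (hn : 0 < n) :
    Real.log (n.factorial : ℝ) ≤ logPrim n + 1 + Real.log n := by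
  obtain ⟨m, rfl⟩ := Nat.exists_eq_add_of_lt hn
  have h := sum_log_le one_pos m
  rw [← log_factorial_eq_sum] at h
  have h1 : logPrim 1 = -1 := by simp [logPrim]
  simp only [zero_add]
  push_cast
  rw [add_comm (m : ℝ) 1]
  linarith

lemma le_log_factorial {n : ℕ} (hn : 0 < n) :
    logPrim n ≤ Real.log (n.factorial : ℝ) := by
  obtain ⟨m, rfl⟩ := Nat.exists_eq_add_of_lt hn
  have h := le_sum_log one_pos m
  rw [← log_factorial_eq_sum, Real.log_one] at h
  have h1 : logPrim 1 = -1 := by simp [logPrim]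
  simp only [zero_add]
  push_cast
  rw [add_comm (m : ℝ) 1]
  linarith

/-- The exponential rate of growth of `R s D n (n + x * n)`, with `A = D` and `B = s + 1`. -/
noncomputable def rate (A B x : ℝ) : ℝ :=
  3 * A * Real.log A + A * ((x + 3) * Real.log (x + 3) - x * Real.log x) -
    B * ((x + 2) * Real.log (x + 2) - (x + 1) * Real.log (x + 1))

/-- The derivative of `rate A B`. -/
noncomputable def rateDeriv (A B x : ℝ) : ℝ :=
  A * (Real.log (x + 3) - Real.log x) - B * (Real.log (x + 2) - Real.log (x + 1))

lemma hasDerivAt_rate (A B : ℝ) {x : ℝ} (hx : 0 < x) :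
    HasDerivAt (rate A B) (rateDeriv A B x) x := by
  have key : ∀ c : ℝ, 0 ≤ c → HasDerivAt (fun x : ℝ => (x + c) * Real.log (x + c))
      (Real.log (x + c) + 1) x := fun c hc =>
    (Real.hasDerivAt_mul_log (by positivity : x + c ≠ 0)).comp_add_const x c
  have h := (((key 3 (by norm_num)).sub (key 0 le_rfl)).const_mul A).sub
    (((key 2 (by norm_num)).sub (key 1 (by norm_num))).const_mul B)
  have h' := h.const_add (3 * A * Real.log A)
  refine (h'.congr_deriv ?_).congr_of_eventuallyEq (Eventually.of_forall fun y => ?_)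
  · simp only [rateDeriv, add_zero]
    ring
  · simp only [rate, Pi.sub_apply, add_zero]
    ring

lemma hasDerivAt_rateDeriv (A B : ℝ) {x : ℝ} (hx : 0 < x) :
    HasDerivAt (rateDeriv A B)
      ((B * (x * (x + 3)) - 3 * A * ((x + 1) * (x + 2))) /
        (x * (x + 1) * (x + 2) * (x + 3))) x := by
  have key : ∀ c : ℝ, 0 ≤ c → HasDerivAt (fun x : ℝ => Real.log (x + c)) (x + c)⁻¹ x :=
    fun c hc => (Real.hasDerivAt_log (by positivity : x + c ≠ 0)).comp_add_const x c
  have h := (((key 3 (by norm_num)).sub (key 0 le_rfl)).const_mul A).sub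
    (((key 2 (by norm_num)).sub (key 1 (by norm_num))).const_mul B)
  refine (h.congr_deriv ?_).congr_of_eventuallyEq (Eventually.of_forall fun y => ?_)
  · rw [add_zero]
    field_simp
    ring
  · simp only [rateDeriv, Pi.sub_apply, add_zero]

lemma tendsto_rateDeriv_atTop (A B : ℝ) : Tendsto (rateDeriv A B) atTop (𝓝 0) := by
  have h3 := (Real.tendsto_log_comp_add_sub_log 3).const_mul A
  have h2 := ((Real.tendsto_log_comp_add_sub_log 2).sub
    (Real.tendsto_log_comp_add_sub_log 1)).const_mul B
  have h := h3.sub h2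
  simp only [mul_zero, sub_zero] at h
  refine h.congr fun x => ?_
  simp [rateDeriv]

lemma rateDeriv_neg {A B x : ℝ} (hAB : 3 * A < B) (hx : 0 < x)
    (hq : 0 ≤ B * (x * (x + 3)) - 3 * A * ((x + 1) * (x + 2))) : rateDeriv A B x < 0 := by
  have hmono : StrictMonoOn (rateDeriv A B) (Set.Ici x) := by
    refine strictMonoOn_of_deriv_pos (convex_Ici x) (fun y hy =>
      (hasDerivAt_rateDeriv A B (hx.trans_le hy)).continuousAt.continuousWithinAt) ?_
    intro y hy
    rw [interior_Ici] at hy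
    have hxy : x < y := hy
    have hy0 : 0 < y := hx.trans hxy
    rw [(hasDerivAt_rateDeriv A B hy0).deriv]
    refine div_pos ?_ (by positivity)
    nlinarith [mul_pos (sub_pos.2 hAB) (mul_pos (sub_pos.2 hxy) (by linarith : 0 < x + y + 3))]
  have hle : rateDeriv A B (x + 1) ≤ 0 := by
    refine ge_of_tendsto (tendsto_rateDeriv_atTop A B) ?_
    filter_upwards [eventually_ge_atTop (x + 1)] with y hy
    exact hmono.monotoneOn (Set.mem_Ici.2 (by linarith)) (Set.mem_Ici.2 (by linarith)) hy
  exact (hmono Set.self_mem_Ici (Set.mem_Ici.2 (by linarith)) (by linarith)).trans_le hle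

lemma antitoneOn_rateDeriv {A B c : ℝ} (hAB : 3 * A < B)
    (hc : B * (c * (c + 3)) - 3 * A * ((c + 1) * (c + 2)) < 0) :
    AntitoneOn (rateDeriv A B) (Set.Ioc 0 c) := by
  refine antitoneOn_of_deriv_nonpos (convex_Ioc 0 c) (fun y hy =>
    (hasDerivAt_rateDeriv A B hy.1).continuousAt.continuousWithinAt) ?_ ?_
  · intro y hy
    rw [interior_Ioc] at hy
    exact (hasDerivAt_rateDeriv A B hy.1).differentiableAt.differentiableWithinAt
  · intro y hy
    rw [interior_Ioc] at hy
    have hy0 : 0 < y := hy.1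
    rw [(hasDerivAt_rateDeriv A B hy0).deriv]
    refine div_nonpos_of_nonpos_of_nonneg ?_ (by positivity)
    nlinarith [mul_pos (sub_pos.2 hAB) (mul_pos (sub_pos.2 hy.2) (by linarith [hy.2] : 0 < c + y + 3))]

lemma rate_le_of_rateDeriv_eq_zero {A B x₀ : ℝ} (hAB : 3 * A < B) (hx₀ : 0 < x₀)
    (h₀ : rateDeriv A B x₀ = 0) {x : ℝ} (hx : 0 < x) : rate A B x ≤ rate A B x₀ := by
  have hq₀ : B * (x₀ * (x₀ + 3)) - 3 * A * ((x₀ + 1) * (x₀ + 2)) < 0 := by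
    by_contra! h
    exact (rateDeriv_neg hAB hx₀ h).ne h₀
  rcases le_total x x₀ with hxx | hxx
  · have hmono : MonotoneOn (rate A B) (Set.Ioc 0 x₀) := by
      refine monotoneOn_of_deriv_nonneg (convex_Ioc 0 x₀) (fun y hy =>
        (hasDerivAt_rate A B hy.1).continuousAt.continuousWithinAt) ?_ ?_
      · intro y hy
        rw [interior_Ioc] at hy
        exact (hasDerivAt_rate A B hy.1).differentiableAt.differentiableWithinAt
      · intro y hy
        rw [interior_Ioc] at hy
        rw [(hasDerivAt_rate A B hy.1).deriv, ← h₀]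
        exact antitoneOn_rateDeriv hAB hq₀ ⟨hy.1, hy.2.le⟩ ⟨hx₀, le_rfl⟩ hy.2.le
    exact hmono ⟨hx, hxx⟩ ⟨hx₀, le_rfl⟩ hxx
  · have hanti : AntitoneOn (rate A B) (Set.Ici x₀) := by
      refine antitoneOn_of_deriv_nonpos (convex_Ici x₀) (fun y hy =>
        (hasDerivAt_rate A B (hx₀.trans_le hy)).continuousAt.continuousWithinAt) ?_ ?_
      · intro y hy
        rw [interior_Ici] at hy
        exact (hasDerivAt_rate A B (hx₀.trans hy)).differentiableAt.differentiableWithinAt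
      · intro y hy
        rw [interior_Ici] at hy
        have hxy : x₀ < y := hy
        have hy0 : 0 < y := hx₀.trans hy
        rw [(hasDerivAt_rate A B hy0).deriv]
        rcases lt_or_ge (B * (y * (y + 3)) - 3 * A * ((y + 1) * (y + 2))) 0 with h | h
        · rw [← h₀]
          exact antitoneOn_rateDeriv hAB h ⟨hx₀, hxy.le⟩ ⟨hy0, le_rfl⟩ hxy.le
        · exact (rateDeriv_neg hAB hy0 h).le
    exact hanti Set.self_mem_Ici hxx hxx

lemma rateDeriv_eq_zero_of_root {s D : ℕ} {x₀ : ℝ} (hx₀ : 0 < x₀)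
    (h : (x₀ + 3) ^ D * (x₀ + 1) ^ (s + 1) = x₀ ^ D * (x₀ + 2) ^ (s + 1)) :
    rateDeriv D (s + 1) x₀ = 0 := by
  have h' := congrArg Real.log h
  rw [Real.log_mul (by positivity) (by positivity), Real.log_mul (by positivity) (by positivity),
    Real.log_pow, Real.log_pow, Real.log_pow, Real.log_pow] at h'
  push_cast at h'
  unfold rateDeriv
  linarith

lemma exp_rate_of_rateDeriv_eq_zero {s D : ℕ} {x₀ : ℝ} (hD : 0 < D) (hx₀ : 0 < x₀)
    (h₀ : rateDeriv D (s + 1) x₀ = 0) :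
    Real.exp (rate D (s + 1) x₀) =
      (D : ℝ) ^ (3 * D) * (x₀ + 3) ^ (3 * D) * (x₀ + 1) ^ (s + 1) /
        (x₀ + 2) ^ (2 * (s + 1)) := by
  have hD' : (0 : ℝ) < D := by exact_mod_cast hD
  rw [← Real.exp_log (by positivity : (0 : ℝ) < (D : ℝ) ^ (3 * D) * (x₀ + 3) ^ (3 * D) *
    (x₀ + 1) ^ (s + 1) / (x₀ + 2) ^ (2 * (s + 1)))]
  congr 1
  rw [Real.log_div (by positivity) (by positivity), Real.log_mul (by positivity) (by positivity),
    Real.log_mul (by positivity) (by positivity),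
    Real.log_pow, Real.log_pow, Real.log_pow, Real.log_pow]
  push_cast
  unfold rateDeriv at h₀
  unfold rate
  linear_combination x₀ * h₀

lemma mul_rate_eq {A B n y : ℝ} (hA : 0 < A) (hn : 0 < n) (hy : 0 < y) :
    n * rate A B (y / n) = (B - 3 * A) * logPrim n +
      (logPrim (A * y + 3 * A * n) - logPrim (A * y)) -
        B * (logPrim (n + y + n) - logPrim (n + y)) := by
  obtain ⟨x, rfl⟩ : ∃ x, y = n * x := ⟨y / n, by field_simp⟩
  have hx : 0 < x := pos_of_mul_pos_right hy hn.le
  have e1 : A * (n * x) + 3 * A * n = A * (n * (x + 3)) := by ring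
  have e2 : n + n * x + n = n * (x + 2) := by ring
  have e3 : n + n * x = n * (x + 1) := by ring
  rw [mul_div_cancel_left₀ _ hn.ne', e1, e2, e3]
  unfold logPrim rate
  rw [Real.log_mul hA.ne' (by positivity), Real.log_mul hA.ne' (by positivity),
    Real.log_mul hn.ne' (by positivity), Real.log_mul hn.ne' (by positivity),
    Real.log_mul hn.ne' (by positivity), Real.log_mul hn.ne' (by positivity)]
  ring

lemma R_pos {s D n : ℕ} (hD : 0 < D) {y : ℝ} (hy : 0 < y) : 0 < R s D n (n + y) := by
  have hD' : (0 : ℝ) < D := by exact_mod_cast hD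
  have h1 : 0 < ∏ j ∈ Finset.range (3 * D * n + 1), ((n : ℝ) + y - n + (j : ℝ) / D) :=
    Finset.prod_pos fun i _ => by rw [add_sub_cancel_left]; positivity
  have h2 : 0 < ∏ j ∈ Finset.range (n + 1), ((n : ℝ) + y + j) :=
    Finset.prod_pos fun i _ => by positivity
  unfold R
  positivity

lemma log_R {s D n : ℕ} (hD : 0 < D) (hs : 3 * D ≤ s) {y : ℝ} (hy : 0 < y) :
    Real.log (R s D n (n + y)) = ((s : ℝ) + 1 - 3 * D) * Real.log (n.factorial : ℝ) +
      ∑ i ∈ Finset.range (3 * D * n + 1), Real.log (D * y + i) - Real.log D -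
      (s + 1) * ∑ i ∈ Finset.range (n + 1), Real.log (n + y + i) := by
  have hD' : (0 : ℝ) < D := by exact_mod_cast hD
  have e1 : ∏ j ∈ Finset.range (3 * D * n + 1), ((n : ℝ) + y - n + (j : ℝ) / D) =
      ∏ j ∈ Finset.range (3 * D * n + 1), ((D * y + j) / D) :=
    Finset.prod_congr rfl fun i _ => by field_simp; ring
  have h1 : 0 < ∏ j ∈ Finset.range (3 * D * n + 1), ((D * y + j) / D) :=
    Finset.prod_pos fun i _ => by positivity
  have h2 : 0 < ∏ j ∈ Finset.range (n + 1), ((n : ℝ) + y + j) :=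
    Finset.prod_pos fun i _ => by positivity
  unfold R
  rw [e1, Real.log_div (by positivity) (by positivity),
    Real.log_mul (by positivity) (by positivity), Real.log_mul (by positivity) (by positivity),
    Real.log_pow, Real.log_pow, Real.log_pow,
    Real.log_prod (fun i _ => by positivity), Real.log_prod (fun i _ => by positivity),
    Finset.sum_congr rfl fun (i : ℕ) _ =>
      Real.log_div (by positivity : (D : ℝ) * y + i ≠ 0) hD'.ne',
    Finset.sum_sub_distrib, Finset.sum_const, Finset.card_range, nsmul_eq_mul,
    Nat.cast_sub (by omega)]
  push_cast
  ring

lemma log_R_le {s D n : ℕ} (hD : 0 < D) (hs : 3 * D ≤ s) (hn : 0 < n) {y : ℝ} (hy : 0 < y) :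
    Real.log (R s D n (n + y)) ≤ n * rate D (s + 1) (y / n) +
      (((s : ℝ) + 1 - 3 * D) * (1 + Real.log n) + Real.log 3) - 2 * Real.log (n + y) := by
  have hD' : (0 : ℝ) < D := by exact_mod_cast hD
  have hn' : (1 : ℝ) ≤ n := by exact_mod_cast hn
  have hs' : 3 * (D : ℝ) ≤ s := by exact_mod_cast hs
  have hs3 : (3 : ℝ) ≤ s := by exact_mod_cast (by omega : 3 ≤ s)
  have hfac := mul_le_mul_of_nonneg_left (log_factorial_le hn)
    (by linarith : 0 ≤ (s : ℝ) + 1 - 3 * D)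
  have hnum := sum_log_le (by positivity : 0 < (D : ℝ) * y) (3 * D * n)
  have hden := mul_le_mul_of_nonneg_left (le_sum_log (by positivity : 0 < (n : ℝ) + y) n)
    (by linarith : 0 ≤ (s : ℝ) + 1)
  have hlast : Real.log (D * y + 3 * D * n) ≤ Real.log D + Real.log 3 + Real.log (n + y) := by
    rw [← Real.log_mul (by positivity) (by positivity),
      ← Real.log_mul (by positivity) (by positivity)]
    exact Real.log_le_log (by positivity) (by nlinarith [mul_pos hD' hy])
  have hlog : 0 ≤ Real.log (n + y) := Real.log_nonneg (by linarith)
  have hsl := mul_le_mul_of_nonneg_right (by linarith : (2 : ℝ) ≤ s) hlog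
  push_cast at hnum
  rw [log_R hD hs hy, mul_rate_eq hD' (by linarith) hy]
  linarith

lemma le_log_R {s D n : ℕ} (hD : 0 < D) (hs : 3 * D ≤ s) (hn : 0 < n) {y : ℝ} (hy : 0 < y) :
    n * rate D (s + 1) (y / n) + Real.log y - (s + 1) * Real.log (2 * n + y) ≤
      Real.log (R s D n (n + y)) := by
  have hD' : (0 : ℝ) < D := by exact_mod_cast hD
  have hn' : (0 : ℝ) < n := by exact_mod_cast hn
  have hs' : 3 * (D : ℝ) ≤ s := by exact_mod_cast hs
  have hfac := mul_le_mul_of_nonneg_left (le_log_factorial hn)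
    (by linarith : 0 ≤ (s : ℝ) + 1 - 3 * D)
  have hnum := le_sum_log (by positivity : 0 < (D : ℝ) * y) (3 * D * n)
  have hden := mul_le_mul_of_nonneg_left (sum_log_le (by positivity : 0 < (n : ℝ) + y) n)
    (by positivity : 0 ≤ (s : ℝ) + 1)
  rw [Real.log_mul hD'.ne' hy.ne'] at hnum
  push_cast at hnum
  have e : 2 * (n : ℝ) + y = n + y + n := by ring
  rw [log_R hD hs hy, mul_rate_eq hD' hn' hy, e]
  linarith

lemma R_eq_zero {s D n m j : ℕ} (hD : 0 < D) (hj : j ≤ D) (hm : m + 1 < n) :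
    R s D n ((m : ℝ) + 1 + (j : ℝ) / D) = 0 := by
  have hD' : (D : ℝ) ≠ 0 := by positivity
  have hle : D * (m + 1) + j ≤ D * n := by nlinarith
  have hmem : D * n - (D * (m + 1) + j) ∈ Finset.range (3 * D * n + 1) := by
    rw [Finset.mem_range]
    have : D * n ≤ 3 * D * n := by nlinarith
    omega
  unfold R
  rw [Finset.prod_eq_zero hmem, mul_zero, zero_div]
  rw [Nat.cast_sub hle]
  push_cast
  field_simp
  ring

lemma R_add_one_add_div_nonneg {s D n j : ℕ} (hD : 0 < D) (hj1 : 1 ≤ j) (hj : j ≤ D) (m : ℕ) :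
    0 ≤ R s D n ((m : ℝ) + 1 + (j : ℝ) / D) := by
  rcases lt_or_ge (m + 1) n with h | h
  · exact (R_eq_zero hD hj h).ge
  · obtain ⟨k, hk⟩ := Nat.exists_eq_add_of_le h
    have hj' : (0 : ℝ) < j := by exact_mod_cast hj1
    have hD' : (0 : ℝ) < D := by exact_mod_cast hD
    have e : (m : ℝ) + 1 + (j : ℝ) / D = n + (k + (j : ℝ) / D) := by
      rw [← add_assoc]; congr 1; exact_mod_cast hk
    rw [e]
    exact (R_pos hD (by positivity)).le

lemma R_add_one_add_div_le {s D n j : ℕ} {x₀ : ℝ} (hD : 0 < D) (hs : 3 * D ≤ s) (hn : 0 < n)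
    (hx₀ : 0 < x₀) (h₀ : rateDeriv D (s + 1) x₀ = 0) (hj1 : 1 ≤ j) (hj : j ≤ D) (m : ℕ) :
    R s D n ((m : ℝ) + 1 + (j : ℝ) / D) ≤
      Real.exp (n * rate D (s + 1) x₀ +
        (((s : ℝ) + 1 - 3 * D) * (1 + Real.log n) + Real.log 3)) * (1 / ((m : ℝ) + 1) ^ 2) := by
  rcases lt_or_ge (m + 1) n with h | h
  · rw [R_eq_zero hD hj h]
    positivity
  · obtain ⟨k, hk⟩ := Nat.exists_eq_add_of_le h
    have hj' : (0 : ℝ) < j := by exact_mod_cast hj1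
    have hD' : (0 : ℝ) < D := by exact_mod_cast hD
    have hn' : (0 : ℝ) < n := by exact_mod_cast hn
    have hs' : 3 * (D : ℝ) ≤ s := by exact_mod_cast hs
    have e : (m : ℝ) + 1 + (j : ℝ) / D = n + (k + (j : ℝ) / D) := by
      rw [← add_assoc]; congr 1; exact_mod_cast hk
    have hy : 0 < k + (j : ℝ) / D := by positivity
    have hlog := log_R_le hD hs hn hy
    have hrate := mul_le_mul_of_nonneg_left
      (rate_le_of_rateDeriv_eq_zero (by linarith : 3 * (D : ℝ) < s + 1) hx₀ h₀
        (div_pos hy hn')) hn'.le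
    have hm : Real.log ((m : ℝ) + 1) ≤ Real.log (n + (k + (j : ℝ) / D)) := by
      rw [← e]
      exact Real.log_le_log (by positivity) (by linarith [div_pos hj' hD'])
    have e2 : 1 / ((m : ℝ) + 1) ^ 2 = Real.exp (-(2 * Real.log ((m : ℝ) + 1))) := by
      rw [Real.exp_neg, one_div, ← Nat.cast_two (R := ℝ), Real.exp_nat_mul,
        Real.exp_log (by positivity)]
    rw [e, e2, ← Real.exp_add, ← Real.log_le_iff_le_exp (R_pos hD hy)]
    linarith

lemma summable_one_div_add_one_sq : Summable fun m : ℕ => 1 / ((m : ℝ) + 1) ^ 2 := by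
  have h := (summable_nat_add_iff 1).2 (Real.summable_one_div_nat_pow.2 one_lt_two)
  simpa using h

lemma tendsto_log_natCast_div : Tendsto (fun n : ℕ => Real.log n / n) atTop (𝓝 0) :=
  Real.isLittleO_log_id_atTop.tendsto_div_nhds_zero.comp tendsto_natCast_atTop_atTop

lemma tendsto_rpow_one_div_of_log_bounds {S lo up : ℕ → ℝ} {c : ℝ}
    (hlo : Tendsto (fun n : ℕ => lo n / n) atTop (𝓝 c))
    (hup : Tendsto (fun n : ℕ => up n / n) atTop (𝓝 c))
    (h : ∀ᶠ n in atTop, Real.exp (lo n) ≤ S n ∧ S n ≤ Real.exp (up n)) :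
    Tendsto (fun n : ℕ => S n ^ (1 / (n : ℝ))) atTop (𝓝 (Real.exp c)) := by
  refine tendsto_of_tendsto_of_tendsto_of_le_of_le'
    ((Real.continuous_exp.tendsto c).comp hlo) ((Real.continuous_exp.tendsto c).comp hup) ?_ ?_
  · filter_upwards [h] with n hn
    have := Real.rpow_le_rpow (Real.exp_pos _).le hn.1 (by positivity : 0 ≤ 1 / (n : ℝ))
    rwa [← Real.exp_mul, mul_one_div] at this
  · filter_upwards [h] with n hn
    have := Real.rpow_le_rpow ((Real.exp_pos _).le.trans hn.1) hn.2
      (by positivity : 0 ≤ 1 / (n : ℝ))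
    rwa [← Real.exp_mul, mul_one_div] at this

lemma tendsto_tsum_R {s D j : ℕ} {x₀ : ℝ} (hD : 0 < D) (hs : 3 * D ≤ s)
    (hx₀ : 0 < x₀) (h₀ : rateDeriv D (s + 1) x₀ = 0) (hj1 : 1 ≤ j) (hj : j ≤ D) :
    Tendsto (fun n : ℕ => (∑' m : ℕ, R s D n ((m : ℝ) + 1 + (j : ℝ) / D)) ^ (1 / (n : ℝ)))
      atTop (𝓝 (Real.exp (rate D (s + 1) x₀))) := by
  have hD' : (0 : ℝ) < D := by exact_mod_cast hD
  have hj' : (1 : ℝ) ≤ j := by exact_mod_cast hj1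
  have hjD : (j : ℝ) / D ≤ 1 := (div_le_one hD').2 (by exact_mod_cast hj)
  have hDj : 1 / (D : ℝ) ≤ j / D := by gcongr
  have hjpos : 0 < (j : ℝ) / D := by positivity
  have hconst : ∀ a : ℝ, Tendsto (fun n : ℕ => a / (n : ℝ)) atTop (𝓝 0) :=
    tendsto_const_div_atTop_nhds_zero_nat
  set Z : ℝ := ∑' m : ℕ, 1 / ((m : ℝ) + 1) ^ 2 with hZ
  have hZpos : 0 < Z := summable_one_div_add_one_sq.tsum_pos (fun m => by positivity) 0 (by simp)
  set y : ℕ → ℝ := fun n => (⌊x₀ * n⌋₊ : ℝ) + (j : ℝ) / D with hy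
  have hypos : ∀ n, 0 < y n := fun n => by positivity
  have hylim : Tendsto (fun n : ℕ => y n / n) atTop (𝓝 x₀) := by
    have h := ((tendsto_nat_floor_mul_div_atTop hx₀.le).comp
      (tendsto_natCast_atTop_atTop (R := ℝ))).add (hconst ((j : ℝ) / D))
    rw [add_zero] at h
    refine h.congr fun n => ?_
    simp [hy, add_div]
  refine tendsto_rpow_one_div_of_log_bounds
    (lo := fun n => n * rate D (s + 1) (y n / n) - Real.log D -
      (s + 1) * (Real.log (x₀ + 3) + Real.log n))
    (up := fun n => n * rate D (s + 1) x₀ +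
        (((s : ℝ) + 1 - 3 * D) * (1 + Real.log n) + Real.log 3) + Real.log Z) ?_ ?_ ?_
  · have h := (((hasDerivAt_rate D (s + 1) hx₀).continuousAt.tendsto.comp hylim).sub
      (hconst (Real.log D + (s + 1) * Real.log (x₀ + 3)))).sub
      (tendsto_log_natCast_div.const_mul ((s : ℝ) + 1))
    simp only [mul_zero, sub_zero] at h
    refine h.congr' ?_
    filter_upwards [eventually_gt_atTop 0] with n hn
    have hn' : (0 : ℝ) < n := by exact_mod_cast hn
    simp only [Function.comp]
    field_simp
    ring
  · have h := ((hconst ((s : ℝ) + 1 - 3 * D + Real.log 3 + Real.log Z)).const_add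
      (rate D (s + 1) x₀)).add (tendsto_log_natCast_div.const_mul ((s : ℝ) + 1 - 3 * D))
    simp only [mul_zero, add_zero] at h
    refine h.congr' ?_
    filter_upwards [eventually_gt_atTop 0] with n hn
    have hn' : (0 : ℝ) < n := by exact_mod_cast hn
    field_simp
    ring
  · filter_upwards [eventually_gt_atTop 0] with n hn
    have hn' : (1 : ℝ) ≤ n := by exact_mod_cast hn
    have hbound := R_add_one_add_div_le (n := n) hD hs hn hx₀ h₀ hj1 hj
    have hnonneg := R_add_one_add_div_nonneg (s := s) (n := n) hD hj1 hj
    have hsumZ := summable_one_div_add_one_sq.mul_left (Real.exp (n * rate D (s + 1) x₀ +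
        (((s : ℝ) + 1 - 3 * D) * (1 + Real.log n) + Real.log 3)))
    have hsum := Summable.of_nonneg_of_le hnonneg hbound hsumZ
    constructor
    · refine le_trans ?_ (hsum.le_tsum (n - 1 + ⌊x₀ * n⌋₊) fun m _ => hnonneg m)
      have e : ((n - 1 + ⌊x₀ * n⌋₊ : ℕ) : ℝ) + 1 + (j : ℝ) / D = n + y n := by
        push_cast [Nat.cast_sub (Nat.one_le_iff_ne_zero.2 hn.ne')]
        simp only [hy]
        ring
      rw [e, ← Real.le_log_iff_exp_le (R_pos hD (hypos n))]
      refine le_trans ?_ (le_log_R hD hs hn (hypos n))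
      have h1 : -Real.log D ≤ Real.log (y n) := by
        rw [← Real.log_inv, ← one_div]
        refine Real.log_le_log (by positivity) (hDj.trans ?_)
        simp [hy]
      have h2 : Real.log (2 * n + y n) ≤ Real.log (x₀ + 3) + Real.log n := by
        rw [← Real.log_mul (by positivity) (by positivity)]
        refine Real.log_le_log (by have := hypos n; positivity) ?_
        have := Nat.floor_le (by positivity : 0 ≤ x₀ * n)
        simp only [hy]
        linarith
      have h3 := mul_le_mul_of_nonneg_left h2 (by positivity : 0 ≤ (s : ℝ) + 1)
      linarith
    · refine (hsum.tsum_le_tsum hbound hsumZ).trans_eq ?_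
      rw [tsum_mul_left, Real.exp_add _ (Real.log Z), Real.exp_log hZpos]

theorem stmt11 :
    ∃ C : ℝ, 0 < C ∧ ∀ s D : ℕ, 0 < s → 0 < D → Odd s → 3 * D ≤ s →
      (D = 1 ∨ C ≤ (s : ℝ) / (D * Real.log D)) →
      ∀ x0 : ℝ, 0 < x0 →
        (x0 + 3) ^ D * (x0 + 1) ^ (s + 1) = x0 ^ D * (x0 + 2) ^ (s + 1) →
        ∀ j : ℕ, 1 ≤ j → j ≤ D →
          Filter.Tendsto
            (fun n : ℕ => (∑' m : ℕ, R s D n ((m : ℝ) + 1 + (j : ℝ) / D)) ^ (1 / (n : ℝ)))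
            (Filter.atTop ⊓ Filter.principal {n : ℕ | 0 < n ∧ Even (D * n)})
            (nhds ((D : ℝ) ^ (3 * D) * (x0 + 3) ^ (3 * D) * (x0 + 1) ^ (s + 1) /
              (x0 + 2) ^ (2 * (s + 1)))) := by
  refine ⟨1, one_pos, ?_⟩
  intro s D _ hD _ hs _ x₀ hx₀ hroot j hj1 hj
  have h₀ := rateDeriv_eq_zero_of_root hx₀ hroot
  rw [← exp_rate_of_rateDeriv_eq_zero hD hx₀ h₀]
  exact (tendsto_tsum_R hD hs hx₀ h₀ hj1 hj).mono_left inf_le_left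
end
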